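/- Assume f₀ : 𝒳ⁿ → ℝⁿ is Lipschitz on bounded sets with f₀(0) = 0. The following are equivalent: (1) ẋ(t) = f₀(x_t) is GAS; (2) there exist an LKF V and σ of class 𝒦ℒ such that D⁺V(φ, f₀(φ)) ≤ −σ(|φ(0)|, ‖φ‖) for all φ ∈ 𝒳ⁿ; (3) there exist an LKF V and α of class 𝒫 such that D⁺V(φ, f₀(φ)) ≤ −α(|φ(0)|) for all φ; (4) there exists an LKF V such that D⁺V(φ, f₀(φ)) ≤ −V(φ) for all φ; (5) there exist a coercive LKF V and α of class 𝒦∞ such that D⁺V(φ, f₀(φ)) ≤ −α(‖φ‖) for all φ. -/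

import Mathlib

open Set Filter MeasureTheory Topology
open scoped NNReal

noncomputable section

/-- `ℝⁿ` with the Euclidean norm. -/
abbrev Vec (n : ℕ) : Type := EuclideanSpace ℝ (Fin n)

/-- The state space `𝒳ⁿ = C([-Δ,0], ℝⁿ)`, equipped with the sup norm. -/
abbrev Hist (Δ : ℝ≥0) (n : ℕ) : Type :=
  ContinuousMap (Icc (-(Δ : ℝ)) (0 : ℝ)) (Vec n)

theorem zero_mem_IccD (Δ : ℝ≥0) : (0 : ℝ) ∈ Icc (-(Δ : ℝ)) (0 : ℝ) :=
  ⟨neg_nonpos.mpr Δ.coe_nonneg, le_refl 0⟩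

/-- `φ(0)`: the current value of a history segment. -/
def ev0 {Δ : ℝ≥0} {n : ℕ} (φ : Hist Δ n) : Vec n :=
  φ ⟨0, zero_mem_IccD Δ⟩

/-! ### Comparison functions -/

/-- Class `𝒦`: continuous, strictly increasing, zero at zero (on `[0,∞)`). -/
def ClassK (α : ℝ → ℝ) : Prop :=
  ContinuousOn α (Ici 0) ∧ StrictMonoOn α (Ici 0) ∧ α 0 = 0

/-- Class `𝒦∞`: class `𝒦` and unbounded. -/
def ClassKinf (α : ℝ → ℝ) : Prop :=
  ClassK α ∧ Tendsto α atTop atTop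

/-- Class `𝒩`: continuous, nondecreasing, zero at zero (on `[0,∞)`). -/
def ClassN (α : ℝ → ℝ) : Prop :=
  ContinuousOn α (Ici 0) ∧ MonotoneOn α (Ici 0) ∧ α 0 = 0

/-- Class `𝒫`: continuous, zero at zero, positive on `(0,∞)`. -/
def ClassP (α : ℝ → ℝ) : Prop :=
  ContinuousOn α (Ici 0) ∧ α 0 = 0 ∧ ∀ s : ℝ, 0 < s → 0 < α s

/-- Class `𝒦ℒ`. -/
def ClassKL (β : ℝ → ℝ → ℝ) : Prop :=
  (∀ t : ℝ, 0 ≤ t → ClassK fun s => β s t) ∧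
    ∀ s : ℝ, 0 ≤ s →
      ContinuousOn (β s) (Ici 0) ∧ AntitoneOn (β s) (Ici 0) ∧
        Tendsto (β s) atTop (𝓝 0)

/-! ### Inputs -/

/-- Admissible input: Lebesgue measurable and locally essentially bounded. -/
def IsInput {m : ℕ} (u : ℝ → Vec m) : Prop :=
  Measurable u ∧ ∀ T : ℝ, 0 < T → ∃ C : ℝ, ∀ᵐ t ∂volume, t ∈ Icc (0 : ℝ) T → ‖u t‖ ≤ C

/-- Essential supremum of `‖u‖` over a set of times. -/
def essBnd {m : ℕ} (u : ℝ → Vec m) (s : Set ℝ) : ℝ :=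
  sInf {C : ℝ | 0 ≤ C ∧ ∀ᵐ τ ∂volume, τ ∈ s → ‖u τ‖ ≤ C}

/-! ### History segments along a trajectory -/

-- The history segment `x_t ∈ 𝒳ⁿ` of a trajectory `x : ℝ → ℝⁿ` (with junk value `0`
-- when `x` is not continuous on `[t-Δ, t]`).
open Classical in
def seg (Δ : ℝ≥0) {n : ℕ} (x : ℝ → Vec n) (t : ℝ) : Hist Δ n :=
  if hx : ContinuousOn x (Icc (t - (Δ : ℝ)) t) then
    { toFun := fun τ => x (t + τ.1)
      continuous_toFun := by
        have h1 : Continuous fun τ : Icc (-(Δ : ℝ)) (0 : ℝ) => t + τ.1 :=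
          continuous_const.add continuous_subtype_val
        have h2 : ∀ τ : Icc (-(Δ : ℝ)) (0 : ℝ), t + τ.1 ∈ Icc (t - (Δ : ℝ)) t := by
          rintro ⟨τ, hτ⟩
          rw [mem_Icc] at hτ ⊢
          constructor
          · linarith [hτ.1]
          · linarith [hτ.2]
        exact hx.comp_continuous h1 h2 }
  else 0

/-! ### Driver's derivative and Dini derivative -/

/-- The deformed history `φ_{h,w}` appearing in Driver's derivative: for `0 ≤ h < Δ`,
`φ_{h,w}(s) = φ(s+h)` for `s ∈ [-Δ,-h)` and `φ_{h,w}(s) = φ(0) + w(h+s)` for `s ∈ [-h,0]`. -/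
def shiftSeg {Δ : ℝ≥0} {n : ℕ} (φ : Hist Δ n) (w : Vec n) (h : ℝ) : Hist Δ n :=
  { toFun := fun s =>
      φ (projIcc (-(Δ : ℝ)) 0 (neg_nonpos.mpr Δ.coe_nonneg) (s.1 + h)) + max (h + s.1) 0 • w
    continuous_toFun := by
      refine Continuous.add ?_ ?_
      · exact φ.continuous.comp (continuous_projIcc.comp
          (continuous_subtype_val.add continuous_const))
      · exact ((continuous_const.add continuous_subtype_val).max continuous_const).smul
          continuous_const }

/-- Driver's derivative `D⁺V(φ,w)`, valued in the extended reals. -/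
def driverD {Δ : ℝ≥0} {n : ℕ} (V : Hist Δ n → ℝ) (φ : Hist Δ n) (w : Vec n) : EReal :=
  limsup (fun h : ℝ => (((V (shiftSeg φ w h) - V φ) / h : ℝ) : EReal)) (𝓝[>] (0 : ℝ))

/-- Upper right-hand Dini derivative of `ν : ℝ → ℝ`, valued in the extended reals. -/
def diniD (ν : ℝ → ℝ) (t : ℝ) : EReal :=
  limsup (fun h : ℝ => (((ν (t + h) - ν t) / h : ℝ) : EReal)) (𝓝[>] (0 : ℝ))

/-! ### Lipschitz conditions -/

/-- `f : 𝒳ⁿ × ℝᵐ → ℝⁿ` is Lipschitz on bounded sets. -/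
def LipOnBounded {Δ : ℝ≥0} {n m : ℕ} (f : Hist Δ n → Vec m → Vec n) : Prop :=
  ∀ r : ℝ, 0 < r → ∃ L : ℝ, 0 < L ∧
    ∀ (φ₁ φ₂ : Hist Δ n) (v₁ v₂ : Vec m),
      ‖φ₁‖ ≤ r → ‖φ₂‖ ≤ r → ‖v₁‖ ≤ r → ‖v₂‖ ≤ r →
        ‖f φ₁ v₁ - f φ₂ v₂‖ ≤ L * (‖φ₁ - φ₂‖ + ‖v₁ - v₂‖)

/-- An input-free vector field `f₀ : 𝒳ⁿ → ℝⁿ` Lipschitz on bounded sets. -/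
def LipOnBounded₀ {Δ : ℝ≥0} {n : ℕ} (f₀ : Hist Δ n → Vec n) : Prop :=
  ∀ r : ℝ, 0 < r → ∃ L : ℝ, 0 < L ∧
    ∀ φ₁ φ₂ : Hist Δ n, ‖φ₁‖ ≤ r → ‖φ₂‖ ≤ r → ‖f₀ φ₁ - f₀ φ₂‖ ≤ L * ‖φ₁ - φ₂‖

/-- A functional `V : 𝒳ⁿ → ℝ` Lipschitz on bounded sets. -/
def LipOnBoundedV {Δ : ℝ≥0} {n : ℕ} (V : Hist Δ n → ℝ) : Prop :=
  ∀ r : ℝ, 0 < r → ∃ L : ℝ, 0 < L ∧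
    ∀ φ₁ φ₂ : Hist Δ n, ‖φ₁‖ ≤ r → ‖φ₂‖ ≤ r → |V φ₁ - V φ₂| ≤ L * ‖φ₁ - φ₂‖

/-- A functional `V : 𝒳ⁿ → ℝ` locally Lipschitz. -/
def LocallyLipV {Δ : ℝ≥0} {n : ℕ} (V : Hist Δ n → ℝ) : Prop :=
  ∀ φ : Hist Δ n, ∃ δ : ℝ, 0 < δ ∧ ∃ L : ℝ, 0 < L ∧
    ∀ φ₁ φ₂ : Hist Δ n, ‖φ₁ - φ‖ ≤ δ → ‖φ₂ - φ‖ ≤ δ → |V φ₁ - V φ₂| ≤ L * ‖φ₁ - φ₂‖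

/-! ### Solutions -/

/-- `x` is a solution of `ẋ(t) = f(x_t, u(t))` with initial state `x₀` on `[0, tmax)`. -/
structure IsSolution (Δ : ℝ≥0) {n m : ℕ} (f : Hist Δ n → Vec m → Vec n)
    (u : ℝ → Vec m) (x₀ : Hist Δ n) (tmax : EReal) (x : ℝ → Vec n) : Prop where
  tmax_pos : 0 < tmax
  cont : ContinuousOn x {s : ℝ | -(Δ : ℝ) ≤ s ∧ (s : EReal) < tmax}
  init : ∀ τ : Icc (-(Δ : ℝ)) (0 : ℝ), x τ.1 = x₀ τ
  integrable : ∀ t : ℝ, 0 ≤ t → (t : EReal) < tmax →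
    IntervalIntegrable (fun s => f (seg Δ x s) (u s)) volume 0 t
  integral_eq : ∀ t : ℝ, 0 ≤ t → (t : EReal) < tmax →
    x t = x 0 + ∫ s in (0:ℝ)..t, f (seg Δ x s) (u s)

/-- Maximal solution: a solution admitting no proper extension. -/
def IsMaxSolution (Δ : ℝ≥0) {n m : ℕ} (f : Hist Δ n → Vec m → Vec n)
    (u : ℝ → Vec m) (x₀ : Hist Δ n) (tmax : EReal) (x : ℝ → Vec n) : Prop :=
  IsSolution Δ f u x₀ tmax x ∧
    ∀ (tmax' : EReal) (x' : ℝ → Vec n), IsSolution Δ f u x₀ tmax' x' →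
      (∀ t : ℝ, -(Δ : ℝ) ≤ t → (t : EReal) < tmax → x' t = x t) → tmax' ≤ tmax

/-- Solution of the input-free system `ẋ(t) = f₀(x_t)`. -/
def IsSolution₀ (Δ : ℝ≥0) {n : ℕ} (f₀ : Hist Δ n → Vec n) (x₀ : Hist Δ n)
    (tmax : EReal) (x : ℝ → Vec n) : Prop :=
  IsSolution Δ (fun φ (_ : Vec 0) => f₀ φ) (fun _ => 0) x₀ tmax x

/-- Maximal solution of the input-free system `ẋ(t) = f₀(x_t)`. -/
def IsMaxSolution₀ (Δ : ℝ≥0) {n : ℕ} (f₀ : Hist Δ n → Vec n) (x₀ : Hist Δ n)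
    (tmax : EReal) (x : ℝ → Vec n) : Prop :=
  IsMaxSolution Δ (fun φ (_ : Vec 0) => f₀ φ) (fun _ => 0) x₀ tmax x

/-! ### Stability properties (input-free systems) -/

/-- Global asymptotic stability (GAS). -/
def GAS (Δ : ℝ≥0) {n : ℕ} (f₀ : Hist Δ n → Vec n) : Prop :=
  ∃ β : ℝ → ℝ → ℝ, ClassKL β ∧
    ∀ (x₀ : Hist Δ n) (tmax : EReal) (x : ℝ → Vec n),
      IsMaxSolution₀ Δ f₀ x₀ tmax x →
        tmax = ⊤ ∧ ∀ t : ℝ, 0 ≤ t → ‖x t‖ ≤ β ‖x₀‖ t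

/-- Global exponential stability (GES). -/
def GES (Δ : ℝ≥0) {n : ℕ} (f₀ : Hist Δ n → Vec n) : Prop :=
  ∃ k : ℝ, 1 ≤ k ∧ ∃ lam : ℝ, 0 < lam ∧
    ∀ (x₀ : Hist Δ n) (tmax : EReal) (x : ℝ → Vec n),
      IsMaxSolution₀ Δ f₀ x₀ tmax x →
        tmax = ⊤ ∧ ∀ t : ℝ, 0 ≤ t → ‖x t‖ ≤ k * ‖x₀‖ * Real.exp (-lam * t)

/-- (Local) asymptotic stability (AS) of the origin. -/
def AS (Δ : ℝ≥0) {n : ℕ} (f₀ : Hist Δ n → Vec n) : Prop :=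
  ∃ r : ℝ, 0 < r ∧ ∃ β : ℝ → ℝ → ℝ, ClassKL β ∧
    ∀ (x₀ : Hist Δ n) (tmax : EReal) (x : ℝ → Vec n),
      IsMaxSolution₀ Δ f₀ x₀ tmax x → ‖x₀‖ ≤ r →
        tmax = ⊤ ∧ ∀ t : ℝ, 0 ≤ t → ‖x t‖ ≤ β ‖x₀‖ t

/-- (Local) exponential stability (ES) of the origin. -/
def ES (Δ : ℝ≥0) {n : ℕ} (f₀ : Hist Δ n → Vec n) : Prop :=
  ∃ r : ℝ, 0 < r ∧ ∃ k : ℝ, 1 ≤ k ∧ ∃ lam : ℝ, 0 < lam ∧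
    ∀ (x₀ : Hist Δ n) (tmax : EReal) (x : ℝ → Vec n),
      IsMaxSolution₀ Δ f₀ x₀ tmax x → ‖x₀‖ ≤ r →
        tmax = ⊤ ∧ ∀ t : ℝ, 0 ≤ t → ‖x t‖ ≤ k * ‖x₀‖ * Real.exp (-lam * t)

/-! ### Forward completeness -/

/-- Robust forward completeness (RFC) of `ẋ(t) = f(x_t,u(t))`. -/
def RFC (Δ : ℝ≥0) {n m : ℕ} (f : Hist Δ n → Vec m → Vec n) : Prop :=
  (∀ (x₀ : Hist Δ n) (u : ℝ → Vec m) (tmax : EReal) (x : ℝ → Vec n),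
      IsInput u → IsMaxSolution Δ f u x₀ tmax x → tmax = ⊤) ∧
    ∀ T : ℝ, 0 < T → ∀ r : ℝ, 0 < r → ∃ C : ℝ,
      ∀ (x₀ : Hist Δ n) (u : ℝ → Vec m) (tmax : EReal) (x : ℝ → Vec n),
        IsInput u → IsMaxSolution Δ f u x₀ tmax x →
          ‖x₀‖ ≤ r → essBnd u (Ici 0) ≤ r →
            ∀ t : ℝ, t ∈ Icc (0 : ℝ) T → ‖seg Δ x t‖ ≤ C

/-- Robust forward completeness of the input-free system `ẋ(t) = f₀(x_t)`. -/
def RFC₀ (Δ : ℝ≥0) {n : ℕ} (f₀ : Hist Δ n → Vec n) : Prop :=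
  RFC Δ (fun φ (_ : Vec 0) => f₀ φ)

/-! ### Input-to-state stability notions -/

/-- Input-to-state stability (ISS). -/
def ISS (Δ : ℝ≥0) {n m : ℕ} (f : Hist Δ n → Vec m → Vec n) : Prop :=
  ∃ β : ℝ → ℝ → ℝ, ∃ μ : ℝ → ℝ, ClassKL β ∧ ClassN μ ∧
    ∀ (x₀ : Hist Δ n) (u : ℝ → Vec m) (tmax : EReal) (x : ℝ → Vec n),
      IsInput u → IsMaxSolution Δ f u x₀ tmax x →
        tmax = ⊤ ∧ ∀ t : ℝ, 0 ≤ t → ‖x t‖ ≤ β ‖x₀‖ t + μ (essBnd u (Icc 0 t))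

/-- Local input-to-state stability (LISS). -/
def LISS (Δ : ℝ≥0) {n m : ℕ} (f : Hist Δ n → Vec m → Vec n) : Prop :=
  ∃ r : ℝ, 0 < r ∧ ∃ β : ℝ → ℝ → ℝ, ∃ μ : ℝ → ℝ, ClassKL β ∧ ClassN μ ∧
    ∀ (x₀ : Hist Δ n) (u : ℝ → Vec m) (tmax : EReal) (x : ℝ → Vec n),
      IsInput u → IsMaxSolution Δ f u x₀ tmax x →
        ‖x₀‖ ≤ r → essBnd u (Ici 0) ≤ r →
          tmax = ⊤ ∧ ∀ t : ℝ, 0 ≤ t → ‖x t‖ ≤ β ‖x₀‖ t + μ (essBnd u (Icc 0 t))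

/-- Integral input-to-state stability (iISS). -/
def iISS (Δ : ℝ≥0) {n m : ℕ} (f : Hist Δ n → Vec m → Vec n) : Prop :=
  ∃ β : ℝ → ℝ → ℝ, ∃ η μ : ℝ → ℝ, ClassKL β ∧ ClassN η ∧ ClassN μ ∧
    ∀ (x₀ : Hist Δ n) (u : ℝ → Vec m) (tmax : EReal) (x : ℝ → Vec n),
      IsInput u → IsMaxSolution Δ f u x₀ tmax x →
        tmax = ⊤ ∧ ∀ t : ℝ, 0 ≤ t →
          ‖x t‖ ≤ β ‖x₀‖ t + η (∫ s in (0:ℝ)..t, μ ‖u s‖)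

/-- The UBEBS estimate with offset `c`. -/
def UBEBSwith (Δ : ℝ≥0) {n m : ℕ} (f : Hist Δ n → Vec m → Vec n) (c : ℝ) : Prop :=
  ∃ α ξ ζ : ℝ → ℝ, ClassKinf α ∧ ClassKinf ξ ∧ ClassKinf ζ ∧
    ∀ (x₀ : Hist Δ n) (u : ℝ → Vec m) (tmax : EReal) (x : ℝ → Vec n),
      IsInput u → IsMaxSolution Δ f u x₀ tmax x →
        tmax = ⊤ ∧ ∀ t : ℝ, 0 ≤ t →
          α ‖x t‖ ≤ ξ ‖x₀‖ + (∫ s in (0:ℝ)..t, ζ ‖u s‖) + c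

/-! ### Lyapunov–Krasovskii functionals -/

/-- Lyapunov–Krasovskii functional candidate (LKF). -/
def IsLKF {Δ : ℝ≥0} {n : ℕ} (V : Hist Δ n → ℝ) : Prop :=
  (∀ φ, 0 ≤ V φ) ∧ LipOnBoundedV V ∧
    ∃ α₁ α₂ : ℝ → ℝ, ClassKinf α₁ ∧ ClassKinf α₂ ∧
      ∀ φ : Hist Δ n, α₁ ‖ev0 φ‖ ≤ V φ ∧ V φ ≤ α₂ ‖φ‖

/-- Coercive Lyapunov–Krasovskii functional candidate. -/
def IsCoerciveLKF {Δ : ℝ≥0} {n : ℕ} (V : Hist Δ n → ℝ) : Prop :=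
  (∀ φ, 0 ≤ V φ) ∧ LipOnBoundedV V ∧
    ∃ α₁ α₂ : ℝ → ℝ, ClassKinf α₁ ∧ ClassKinf α₂ ∧
      ∀ φ : Hist Δ n, α₁ ‖φ‖ ≤ V φ ∧ V φ ≤ α₂ ‖φ‖

end

section Trajectories

variable {Δ : ℝ≥0} {n : ℕ} {f : Hist Δ n → Vec n}

theorem seg_apply {x : ℝ → Vec n} {t : ℝ} (hx : ContinuousOn x (Icc (t - (Δ : ℝ)) t))
    (τ : Icc (-(Δ : ℝ)) (0 : ℝ)) : seg Δ x t τ = x (t + τ.1) := by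
  rw [seg, dif_pos hx]; rfl

theorem seg_apply_of_continuous {x : ℝ → Vec n} (hx : Continuous x) (t : ℝ)
    (τ : Icc (-(Δ : ℝ)) (0 : ℝ)) : seg Δ x t τ = x (t + τ.1) :=
  seg_apply hx.continuousOn τ

theorem add_mem_window {t : ℝ} (τ : Icc (-(Δ : ℝ)) (0 : ℝ)) :
    t + τ.1 ∈ Icc (t - (Δ : ℝ)) t :=
  ⟨by linarith [τ.2.1], by linarith [τ.2.2]⟩

theorem seg_congr {x y : ℝ → Vec n} {t : ℝ} (h : EqOn x y (Icc (t - (Δ : ℝ)) t)) :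
    seg Δ x t = seg Δ y t := by
  by_cases hx : ContinuousOn x (Icc (t - (Δ : ℝ)) t)
  · have hy : ContinuousOn y (Icc (t - (Δ : ℝ)) t) := hx.congr fun s hs => (h hs).symm
    ext1 τ
    rw [seg_apply hx, seg_apply hy]
    exact h (add_mem_window τ)
  · have hy : ¬ ContinuousOn y (Icc (t - (Δ : ℝ)) t) := fun hy => hx (hy.congr h)
    rw [seg, seg, dif_neg hx, dif_neg hy]

theorem continuous_seg {x : ℝ → Vec n} (hx : Continuous x) : Continuous fun t => seg Δ x t := by
  let F : C(ℝ × Icc (-(Δ : ℝ)) (0 : ℝ), Vec n) :=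
    ⟨fun p => x (p.1 + p.2.1), by fun_prop⟩
  have : (fun t => seg Δ x t) = F.curry := by
    funext t
    ext1 τ
    rw [seg_apply_of_continuous hx]
    rfl
  rw [this]
  exact F.curry.continuous

theorem norm_seg_le {x : ℝ → Vec n} (hx : Continuous x) {t C : ℝ} (hC : 0 ≤ C)
    (h : ∀ s ∈ Icc (t - (Δ : ℝ)) t, ‖x s‖ ≤ C) : ‖seg Δ x t‖ ≤ C := by
  rw [ContinuousMap.norm_le _ hC]
  intro τ
  rw [seg_apply_of_continuous hx]
  exact h _ (add_mem_window τ)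

theorem norm_le_norm_seg {x : ℝ → Vec n} (hx : Continuous x) {t s : ℝ}
    (hs : s ∈ Icc (t - (Δ : ℝ)) t) : ‖x s‖ ≤ ‖seg Δ x t‖ := by
  have := (seg Δ x t).norm_coe_le_norm ⟨s - t, by linarith [hs.1], by linarith [hs.2]⟩
  rw [seg_apply_of_continuous hx] at this
  simpa using this

theorem ev0_seg {x : ℝ → Vec n} (hx : Continuous x) (t : ℝ) : ev0 (seg Δ x t) = x t := by
  rw [ev0, seg_apply_of_continuous hx]
  simp

theorem norm_ev0_le (φ : Hist Δ n) : ‖ev0 φ‖ ≤ ‖φ‖ := φ.norm_coe_le_norm _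

theorem seg_comp_add {x : ℝ → Vec n} (hx : Continuous x) (h t : ℝ) :
    seg Δ (fun s => x (s + h)) t = seg Δ x (t + h) := by
  ext1 τ
  rw [seg_apply_of_continuous hx, seg_apply_of_continuous (by fun_prop)]
  congr 1; ring

theorem LipOnBounded₀.continuous (hf : LipOnBounded₀ f) : Continuous f := by
  rw [continuous_iff_continuousAt]
  intro φ
  obtain ⟨L, hL, h⟩ := hf (‖φ‖ + 1) (by positivity)
  rw [Metric.continuousAt_iff]
  intro ε hε
  refine ⟨min 1 (ε / L), by positivity, fun {ψ} hψ => ?_⟩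
  rw [dist_eq_norm, lt_min_iff] at hψ
  have h1 : ‖ψ‖ ≤ ‖φ‖ + 1 := by
    have := norm_le_insert' ψ φ
    linarith [hψ.1]
  rw [dist_eq_norm]
  calc _ ≤ L * ‖ψ - φ‖ := h ψ φ h1 (by linarith)
    _ < L * (ε / L) := by gcongr; exact hψ.2
    _ = ε := by field_simp

/-- A trajectory of `ẋ(t) = f(x_t)` on `[0, T]`, extended to a continuous function on `ℝ`. -/
structure IsTraj (Δ : ℝ≥0) {n : ℕ} (f : Hist Δ n → Vec n) (φ : Hist Δ n) (T : ℝ)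
    (x : ℝ → Vec n) : Prop where
  cont : Continuous x
  init : ∀ τ : Icc (-(Δ : ℝ)) (0 : ℝ), x τ.1 = φ τ
  integral_eq : ∀ t ∈ Icc 0 T, x t = x 0 + ∫ s in (0 : ℝ)..t, f (seg Δ x s)

namespace IsTraj

variable {φ ψ : Hist Δ n} {T T' : ℝ} {x y : ℝ → Vec n}

theorem mono (hx : IsTraj Δ f φ T x) (h : T' ≤ T) : IsTraj Δ f φ T' x :=
  ⟨hx.cont, hx.init, fun t ht => hx.integral_eq t ⟨ht.1, ht.2.trans h⟩⟩

theorem seg_zero (hx : IsTraj Δ f φ T x) : seg Δ x 0 = φ := by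
  ext1 τ
  rw [seg_apply_of_continuous hx.cont, zero_add, hx.init]

theorem continuous_rhs (hf : LipOnBounded₀ f) (hx : IsTraj Δ f φ T x) :
    Continuous fun s => f (seg Δ x s) :=
  hf.continuous.comp (continuous_seg hx.cont)

theorem sub_eq (hf : LipOnBounded₀ f) (hx : IsTraj Δ f φ T x) {s t : ℝ} (hs : s ∈ Icc 0 T)
    (ht : t ∈ Icc 0 T) : x t - x s = ∫ r in s..t, f (seg Δ x r) := by
  have hi := fun a b => (hx.continuous_rhs hf).intervalIntegrable (μ := volume) a b
  rw [hx.integral_eq t ht, hx.integral_eq s hs,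
    ← intervalIntegral.integral_interval_sub_left (hi 0 t) (hi 0 s)]
  abel

theorem shift (hf : LipOnBounded₀ f) (hx : IsTraj Δ f φ T x) {h : ℝ} (h0 : 0 ≤ h) :
    IsTraj Δ f (seg Δ x h) (T - h) fun t => x (t + h) where
  cont := hx.cont.comp (by fun_prop)
  init τ := by rw [seg_apply_of_continuous hx.cont, add_comm]
  integral_eq t ht := by
    simp_rw [seg_comp_add hx.cont]
    rw [intervalIntegral.integral_comp_add_right (fun s => f (seg Δ x s)),
      ← hx.sub_eq hf ⟨by linarith, by linarith [ht.1, ht.2]⟩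
        ⟨by linarith [ht.1], by linarith [ht.2]⟩]
    abel

theorem glue (hf : LipOnBounded₀ f) (hx : IsTraj Δ f φ T x) (hT : 0 ≤ T)
    (hy : IsTraj Δ f (seg Δ x T) T' y) :
    IsTraj Δ f φ (T + T') fun t => if t ≤ T then x t else y (t - T) := by
  set z : ℝ → Vec n := fun t => if t ≤ T then x t else y (t - T) with hz
  have hyx : ∀ s ∈ Icc (-(Δ : ℝ)) 0, y s = x (T + s) := fun s hs => by
    rw [hy.init ⟨s, hs⟩, seg_apply_of_continuous hx.cont]
  have hy0 : y 0 = x T := by simpa using hyx 0 (zero_mem_IccD Δ)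
  have hzc : Continuous z := by
    refine Continuous.if_le hx.cont (hy.cont.comp (by fun_prop)) continuous_id continuous_const ?_
    rintro t rfl
    simp [hy0]
  have hz1 : ∀ t ≤ T, z t = x t := fun t ht => by simp [hz, ht]
  have hz2 : ∀ t, T - (Δ : ℝ) ≤ t → z t = y (t - T) := fun t ht => by
    by_cases h : t ≤ T
    · rw [hz1 t h, hyx (t - T) ⟨by linarith, by linarith⟩]
      congr 1; ring
    · simp [hz, h]
  have hs1 : ∀ t ≤ T, seg Δ z t = seg Δ x t := fun t ht =>
    seg_congr fun s hs => hz1 s (hs.2.trans ht)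
  have hs2 : ∀ t, T ≤ t → seg Δ z t = seg Δ y (t - T) := fun t ht => by
    ext1 τ
    rw [seg_apply_of_continuous hzc, seg_apply_of_continuous hy.cont,
      hz2 _ (by linarith [τ.2.1])]
    congr 1; ring
  have hzi : ∀ a b, IntervalIntegrable (fun s => f (seg Δ z s)) volume a b := fun a b =>
    (hf.continuous.comp (continuous_seg hzc)).intervalIntegrable a b
  refine ⟨hzc, fun τ => ?_, fun t ht => ?_⟩
  · rw [← hx.init]; exact hz1 _ (τ.2.2.trans hT)
  · rw [hz1 0 hT]
    have key : ∀ t ∈ Icc 0 T, x t = x 0 + ∫ s in (0 : ℝ)..t, f (seg Δ z s) := fun t ht => by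
      rw [hx.integral_eq t ht]
      congr 1
      refine intervalIntegral.integral_congr fun s hs => ?_
      rw [uIcc_of_le ht.1] at hs
      simp only [hs1 s (hs.2.trans ht.2)]
    by_cases h : t ≤ T
    · rw [hz1 t h]; exact key t ⟨ht.1, h⟩
    · push Not at h
      rw [hz2 t (by linarith [Δ.coe_nonneg]), hy.integral_eq _ ⟨by linarith, by linarith [ht.2]⟩,
        hy0, key T ⟨hT, le_rfl⟩, add_assoc,
        ← intervalIntegral.integral_add_adjacent_intervals (hzi 0 T) (hzi T t)]
      congr 2
      have : ∫ s in T..t, f (seg Δ z s) = ∫ s in T..t, f (seg Δ y (s - T)) := by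
        refine intervalIntegral.integral_congr fun s hs => ?_
        rw [uIcc_of_le h.le] at hs
        simp only [hs2 s hs.1]
      rw [this, intervalIntegral.integral_comp_sub_right (fun s => f (seg Δ y s)), sub_self]

theorem exists_norm_seg_le (hx : IsTraj Δ f φ T x) :
    ∃ M : ℝ, 0 < M ∧ ∀ t ∈ Icc 0 T, ‖seg Δ x t‖ ≤ M := by
  obtain ⟨M, hM⟩ := (isCompact_Icc (a := (0 : ℝ)) (b := T)).exists_bound_of_continuousOn
    (continuous_seg (Δ := Δ) hx.cont).continuousOn
  exact ⟨max M 1, by positivity, fun t ht => (hM t ht).trans (le_max_left _ _)⟩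

/-- Continuous dependence of trajectories on the initial history. -/
theorem norm_seg_sub_le (hf : LipOnBounded₀ f) (hx : IsTraj Δ f φ T x) (hy : IsTraj Δ f ψ T y)
    {M L : ℝ} (hL : 0 ≤ L)
    (hfL : ∀ φ₁ φ₂ : Hist Δ n, ‖φ₁‖ ≤ M → ‖φ₂‖ ≤ M → ‖f φ₁ - f φ₂‖ ≤ L * ‖φ₁ - φ₂‖)
    (hxM : ∀ t ∈ Icc 0 T, ‖seg Δ x t‖ ≤ M) (hyM : ∀ t ∈ Icc 0 T, ‖seg Δ y t‖ ≤ M) :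
    ∀ t ∈ Icc 0 T, ‖seg Δ x t - seg Δ y t‖ ≤ ‖φ - ψ‖ * Real.exp (L * t) := by
  have huc : Continuous fun s => L * ‖seg Δ x s - seg Δ y s‖ :=
    continuous_const.mul
      ((continuous_seg (Δ := Δ) hx.cont).sub (continuous_seg (Δ := Δ) hy.cont)).norm
  set u : ℝ → ℝ := fun s => L * ‖seg Δ x s - seg Δ y s‖ with hu
  have hu0 : ∀ s, 0 ≤ u s := fun s => mul_nonneg hL (norm_nonneg _)
  have hui := fun a b => huc.intervalIntegrable (μ := volume) a b
  set F : ℝ → ℝ := fun t => ‖φ - ψ‖ + ∫ s in (0 : ℝ)..t, u s with hF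
  have hFmono : ∀ s t, 0 ≤ s → s ≤ t → F s ≤ F t := fun s t hs hst => by
    have := intervalIntegral.integral_add_adjacent_intervals (hui 0 s) (hui s t)
    have h2 : 0 ≤ ∫ r in s..t, u r := intervalIntegral.integral_nonneg hst fun r _ => hu0 r
    simp only [hF]
    linarith
  have hF0 : F 0 = ‖φ - ψ‖ := by simp [hF]
  have hxy0 : x 0 - y 0 = (φ - ψ) ⟨0, zero_mem_IccD Δ⟩ := by
    have h1 := hx.init ⟨0, zero_mem_IccD Δ⟩
    have h2 := hy.init ⟨0, zero_mem_IccD Δ⟩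
    simp only at h1 h2
    rw [h1, h2]; rfl
  have hpt : ∀ t ∈ Icc 0 T, ‖x t - y t‖ ≤ F t := fun t ht => by
    rw [hx.integral_eq t ht, hy.integral_eq t ht, add_sub_add_comm,
      ← intervalIntegral.integral_sub ((hx.continuous_rhs hf).intervalIntegrable _ _)
        ((hy.continuous_rhs hf).intervalIntegrable _ _), hxy0]
    refine (norm_add_le _ _).trans (add_le_add (ContinuousMap.norm_coe_le_norm _ _) ?_)
    refine intervalIntegral.norm_integral_le_of_norm_le ht.1 (ae_of_all _ fun s hs => ?_) (hui 0 t)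
    have hs' : s ∈ Icc 0 T := ⟨hs.1.le, hs.2.trans ht.2⟩
    exact hfL _ _ (hxM s hs') (hyM s hs')
  have hle : ∀ t ∈ Icc 0 T, ‖seg Δ x t - seg Δ y t‖ ≤ F t := fun t ht => by
    have h0 : F 0 ≤ F t := hFmono 0 t le_rfl ht.1
    rw [ContinuousMap.norm_le _ (by rw [hF0] at h0; exact (norm_nonneg _).trans h0)]
    intro τ
    rw [ContinuousMap.sub_apply, seg_apply_of_continuous hx.cont, seg_apply_of_continuous hy.cont]
    by_cases h : t + τ.1 ≤ 0
    · have hm : t + τ.1 ∈ Icc (-(Δ : ℝ)) 0 := ⟨by linarith [τ.2.1, ht.1], h⟩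
      rw [hx.init ⟨_, hm⟩, hy.init ⟨_, hm⟩, ← ContinuousMap.sub_apply]
      exact (ContinuousMap.norm_coe_le_norm _ _).trans (hF0 ▸ h0)
    · push Not at h
      have h3 : t + τ.1 ≤ t := by linarith [τ.2.2]
      exact (hpt _ ⟨h.le, h3.trans ht.2⟩).trans (hFmono _ _ h.le h3)
  intro t ht
  have hder : ∀ s, HasDerivAt F (u s) s := fun s =>
    (intervalIntegral.integral_hasDerivAt_right (hui 0 s)
      huc.aestronglyMeasurable.stronglyMeasurableAtFilter huc.continuousAt).const_add _
  have hFnn : ∀ s ∈ Icc 0 T, 0 ≤ F s := fun s hs => (norm_nonneg _).trans (hle s hs)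
  have := norm_le_gronwallBound_of_norm_deriv_right_le (f := F) (f' := u) (δ := ‖φ - ψ‖) (K := L)
    (ε := 0) (a := 0) (b := T) (fun s _ => (hder s).continuousAt.continuousWithinAt)
    (fun s _ => (hder s).hasDerivWithinAt) (by rw [hF0, norm_norm])
    (fun s hs => by
      have hs' : s ∈ Icc 0 T := ⟨hs.1, hs.2.le⟩
      rw [Real.norm_of_nonneg (hu0 s), Real.norm_of_nonneg (hFnn s hs'), add_zero]
      exact mul_le_mul_of_nonneg_left (hle s hs') hL) t ht
  rw [gronwallBound_ε0, sub_zero, Real.norm_of_nonneg (hFnn t ht)] at this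
  exact (hle t ht).trans this

theorem seg_unique (hf : LipOnBounded₀ f) (hx : IsTraj Δ f φ T x) (hy : IsTraj Δ f φ T y) {t : ℝ}
    (ht : t ∈ Icc 0 T) : seg Δ x t = seg Δ y t := by
  obtain ⟨M, hM, hxM⟩ := hx.exists_norm_seg_le
  obtain ⟨N, hN, hyN⟩ := hy.exists_norm_seg_le
  obtain ⟨L, hL, hfL⟩ := hf (max M N) (by positivity)
  have := hx.norm_seg_sub_le hf hy hL.le hfL (fun t ht => (hxM t ht).trans (le_max_left _ _))
    (fun t ht => (hyN t ht).trans (le_max_right _ _)) t ht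
  rw [sub_self, norm_zero, zero_mul] at this
  exact sub_eq_zero.mp (norm_le_zero_iff.mp this)

theorem unique (hf : LipOnBounded₀ f) (hx : IsTraj Δ f φ T x) (hy : IsTraj Δ f φ T y) {t : ℝ}
    (ht : t ∈ Icc (-(Δ : ℝ)) T) : x t = y t := by
  by_cases h : t ≤ 0
  · rw [hx.init ⟨t, ht.1, h⟩, hy.init ⟨t, ht.1, h⟩]
  · push Not at h
    rw [← ev0_seg (Δ := Δ) hx.cont, ← ev0_seg (Δ := Δ) hy.cont,
      hx.seg_unique hf hy ⟨h.le, ht.2⟩]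

end IsTraj

end Trajectories

section Existence

variable {Δ : ℝ≥0} {n : ℕ} {f : Hist Δ n → Vec n}

theorem LipOnBounded₀.norm_le (hf0 : f 0 = 0) {M L : ℝ} (hM : 0 ≤ M)
    (hfL : ∀ φ₁ φ₂ : Hist Δ n, ‖φ₁‖ ≤ M → ‖φ₂‖ ≤ M → ‖f φ₁ - f φ₂‖ ≤ L * ‖φ₁ - φ₂‖)
    {φ : Hist Δ n} (hφ : ‖φ‖ ≤ M) : ‖f φ‖ ≤ L * ‖φ‖ := by
  simpa [hf0] using hfL φ 0 hφ (by simpa using hM)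

/-- Local existence, with an existence time uniform over bounded sets of initial histories. -/
theorem exists_isTraj (hf : LipOnBounded₀ f) (hf0 : f 0 = 0) {R : ℝ} (hR : 0 < R) :
    ∃ δ : ℝ, 0 < δ ∧ ∀ φ : Hist Δ n, ‖φ‖ ≤ R → ∃ x, IsTraj Δ f φ δ x := by
  obtain ⟨L, hL, hfL⟩ := hf (R + 1) (by positivity)
  refine ⟨min (1 / (L * (R + 1))) (1 / (2 * L)), by positivity, fun φ hφ => ?_⟩
  set δ : ℝ := min (1 / (L * (R + 1))) (1 / (2 * L)) with hδ
  have hδ0 : 0 < δ := by positivity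
  have hδ1 : L * (R + 1) * δ ≤ 1 := by
    calc _ ≤ L * (R + 1) * (1 / (L * (R + 1))) := by gcongr; exact min_le_left _ _
      _ = 1 := by field_simp
  have hδ2 : L * δ ≤ 1 / 2 := by
    calc _ ≤ L * (1 / (2 * L)) := by gcongr; exact min_le_right _ _
      _ = 1 / 2 := by field_simp
  let X : C(Icc (0 : ℝ) δ, Vec n) → ℝ → Vec n := fun y s =>
    φ (projIcc (-(Δ : ℝ)) 0 (neg_nonpos.mpr Δ.coe_nonneg) s) + y (projIcc 0 δ hδ0.le s)
  have hXc : ∀ y, Continuous (X y) := fun y =>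
    (φ.continuous.comp continuous_projIcc).add (y.continuous.comp continuous_projIcc)
  have hXb : ∀ y, ‖y‖ ≤ 1 → ∀ s, ‖seg Δ (X y) s‖ ≤ R + 1 := fun y hy s =>
    norm_seg_le (hXc y) (by positivity) fun s _ => (norm_add_le _ _).trans
      (add_le_add ((φ.norm_coe_le_norm _).trans hφ) ((y.norm_coe_le_norm _).trans hy))
  have hXs : ∀ y z s, ‖seg Δ (X y) s - seg Δ (X z) s‖ ≤ ‖y - z‖ := fun y z s => by
    rw [ContinuousMap.norm_le _ (norm_nonneg _)]
    intro τ
    rw [ContinuousMap.sub_apply, seg_apply_of_continuous (hXc y), seg_apply_of_continuous (hXc z)]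
    simp only [X, add_sub_add_left_eq_sub]
    exact (y - z).norm_coe_le_norm _
  have hgc : ∀ y, Continuous fun s => f (seg Δ (X y) s) := fun y =>
    hf.continuous.comp (continuous_seg (hXc y))
  let P : C(Icc (0 : ℝ) δ, Vec n) → C(Icc (0 : ℝ) δ, Vec n) := fun y =>
    ⟨fun t => ∫ s in (0 : ℝ)..t.1, f (seg Δ (X y) s),
      (intervalIntegral.continuous_primitive
        (fun a b => (hgc y).intervalIntegrable a b) 0).comp continuous_subtype_val⟩
  have hP : ∀ y z, ‖y‖ ≤ 1 → ‖z‖ ≤ 1 → ‖P y - P z‖ ≤ 1 / 2 * ‖y - z‖ := fun y z hy hz => by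
    rw [ContinuousMap.norm_le _ (by positivity)]
    intro t
    rw [ContinuousMap.sub_apply]
    simp only [P, ContinuousMap.coe_mk]
    rw [← intervalIntegral.integral_sub ((hgc y).intervalIntegrable _ _)
      ((hgc z).intervalIntegrable _ _)]
    have := intervalIntegral.norm_integral_le_of_norm_le_const (a := 0) (b := t.1)
      (C := L * ‖y - z‖) (f := fun s => f (seg Δ (X y) s) - f (seg Δ (X z) s)) fun s _ =>
        (hfL _ _ (hXb y hy s) (hXb z hz s)).trans (mul_le_mul_of_nonneg_left (hXs y z s) hL.le)
    rw [sub_zero, abs_of_nonneg t.2.1] at this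
    calc _ ≤ L * ‖y - z‖ * t.1 := this
      _ ≤ L * ‖y - z‖ * δ := by gcongr; exact t.2.2
      _ = L * δ * ‖y - z‖ := by ring
      _ ≤ _ := by gcongr
  have hmaps : MapsTo P (Metric.closedBall 0 1) (Metric.closedBall 0 1) := fun y hy => by
    rw [mem_closedBall_zero_iff] at hy ⊢
    rw [ContinuousMap.norm_le _ zero_le_one]
    intro t
    simp only [P, ContinuousMap.coe_mk]
    have := intervalIntegral.norm_integral_le_of_norm_le_const (a := 0) (b := t.1)
      (C := L * (R + 1)) (f := fun s => f (seg Δ (X y) s)) fun s _ =>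
        (LipOnBounded₀.norm_le hf0 (by positivity) hfL (hXb y hy s)).trans
          (mul_le_mul_of_nonneg_left (hXb y hy s) hL.le)
    rw [sub_zero, abs_of_nonneg t.2.1] at this
    calc _ ≤ L * (R + 1) * t.1 := this
      _ ≤ L * (R + 1) * δ := by gcongr; exact t.2.2
      _ ≤ 1 := hδ1
  have hcontr : ContractingWith (1 / 2 : ℝ≥0) (hmaps.restrict P _ _) := by
    refine ⟨by rw [← NNReal.coe_lt_coe]; norm_num, LipschitzWith.of_dist_le_mul fun y z => ?_⟩
    rw [Subtype.dist_eq, Subtype.dist_eq, dist_eq_norm, dist_eq_norm]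
    have := hP y.1 z.1 (mem_closedBall_zero_iff.mp y.2) (mem_closedBall_zero_iff.mp z.2)
    simpa using this
  obtain ⟨y, -, hy, -⟩ := ContractingWith.exists_fixedPoint' (x := 0)
    Metric.isClosed_closedBall.isComplete hmaps hcontr (by simp) (edist_ne_top _ _)
  have hyt : ∀ t : Icc (0 : ℝ) δ, y t = ∫ s in (0 : ℝ)..t.1, f (seg Δ (X y) s) := fun t =>
    (congrArg (fun z : C(Icc (0 : ℝ) δ, Vec n) => z t) hy).symm
  have hy0 : y ⟨0, le_rfl, hδ0.le⟩ = 0 := by rw [hyt]; simp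
  refine ⟨X y, hXc y, fun τ => ?_, fun t ht => ?_⟩
  · simp only [X]
    rw [projIcc_of_le_left _ τ.2.2, hy0, add_zero, projIcc_val]
  · simp only [X]
    rw [projIcc_of_right_le _ ht.1, projIcc_right, projIcc_left, hy0, add_zero,
      projIcc_of_mem _ ht, hyt]

theorem IsTraj.isSolution (hf : LipOnBounded₀ f) {φ : Hist Δ n} {T : ℝ} {x : ℝ → Vec n}
    (hx : IsTraj Δ f φ T x) (hT : 0 < T) : IsSolution₀ Δ f φ T x where
  tmax_pos := by exact_mod_cast hT
  cont := hx.cont.continuousOn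
  init := hx.init
  integrable t _ _ := (hx.continuous_rhs hf).intervalIntegrable _ _
  integral_eq t h0 ht := hx.integral_eq t ⟨h0, by exact_mod_cast ht.le⟩

theorem IsSolution.exists_isTraj {φ : Hist Δ n} {b : EReal} {x : ℝ → Vec n}
    (hx : IsSolution₀ Δ f φ b x) {T : ℝ} (h0 : 0 ≤ T) (hT : (T : EReal) < b) :
    ∃ z, IsTraj Δ f φ T z ∧ EqOn z x (Icc (-(Δ : ℝ)) T) := by
  have hle : -(Δ : ℝ) ≤ T := by linarith [Δ.coe_nonneg]
  have hcT : ContinuousOn x (Icc (-(Δ : ℝ)) T) := hx.cont.mono fun s hs =>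
    ⟨hs.1, lt_of_le_of_lt (by exact_mod_cast hs.2) hT⟩
  set z : ℝ → Vec n := fun t => x (projIcc (-(Δ : ℝ)) T hle t) with hz
  have hzx : EqOn z x (Icc (-(Δ : ℝ)) T) := fun s hs => by
    simp only [hz]; rw [projIcc_of_mem _ hs]
  refine ⟨z, ⟨?_, fun τ => ?_, fun t ht => ?_⟩, hzx⟩
  · exact hcT.comp_continuous (continuous_subtype_val.comp continuous_projIcc) fun t => (projIcc _ _ _ t).2
  · rw [hzx ⟨τ.2.1, τ.2.2.trans h0⟩]; exact hx.init τ
  · rw [hzx ⟨by linarith [ht.1, Δ.coe_nonneg], ht.2⟩, hzx ⟨by linarith [Δ.coe_nonneg], h0⟩,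
      hx.integral_eq t ht.1 (lt_of_le_of_lt (by exact_mod_cast ht.2) hT)]
    congr 1
    refine intervalIntegral.integral_congr fun s hs => ?_
    rw [uIcc_of_le ht.1] at hs
    rw [seg_congr fun r hr => hzx ⟨by linarith [hr.1, hs.1], hr.2.trans (hs.2.trans ht.2)⟩]

/-- A maximal solution that stays bounded is global. -/
theorem IsMaxSolution.eq_top_of_bounded (hf : LipOnBounded₀ f) (hf0 : f 0 = 0) {φ : Hist Δ n}
    {b : EReal} {x : ℝ → Vec n} (hx : IsMaxSolution₀ Δ f φ b x) {R : ℝ} (hR : 0 < R)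
    (hb : ∀ (T : ℝ) (z : ℝ → Vec n), 0 ≤ T → (T : EReal) < b → IsTraj Δ f φ T z →
      ‖seg Δ z T‖ ≤ R) : b = ⊤ := by
  by_contra hbt
  obtain ⟨δ, hδ, hex⟩ := exists_isTraj hf hf0 hR
  have hpos := hx.1.tmax_pos
  lift b to ℝ using ⟨hbt, (EReal.bot_lt_zero.trans hpos).ne'⟩
  have hpos' : 0 < b := by exact_mod_cast hpos
  set T := max 0 (b - δ / 2) with hT
  have hTb : T < b := max_lt hpos' (by linarith)
  have hT0 : 0 ≤ T := le_max_left _ _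
  have hTb' : (T : EReal) < b := by exact_mod_cast hTb
  have hTδ : b < T + δ := by linarith [le_max_right 0 (b - δ / 2)]
  obtain ⟨z, hz, -⟩ := IsSolution.exists_isTraj hx.1 hT0 hTb'
  obtain ⟨y, hy⟩ := hex _ (hb T z hT0 hTb' hz)
  have hg := hz.glue hf hT0 hy
  have := hx.2 (T + δ : ℝ) _ (hg.isSolution hf (by linarith)) fun t ht htb => by
    have htb' : t < b := by exact_mod_cast htb
    have hm : max t 0 < b := max_lt htb' hpos'
    obtain ⟨w, hw, hwx⟩ := IsSolution.exists_isTraj hx.1 (le_max_right t 0)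
      (by exact_mod_cast hm)
    rw [← hwx ⟨ht, le_max_left _ _⟩]
    exact (hg.mono (by linarith)).unique hf hw ⟨ht, le_max_left _ _⟩
  have : T + δ ≤ b := by exact_mod_cast this
  linarith

/-- Maximal solutions exist. -/
theorem exists_isMaxSolution (hf : LipOnBounded₀ f) (hf0 : f 0 = 0) (φ : Hist Δ n) :
    ∃ b x, IsMaxSolution₀ Δ f φ b x := by
  classical
  set S : Set ℝ := {T | 0 < T ∧ ∃ x, IsTraj Δ f φ T x} with hS
  obtain ⟨δ, hδ, hex⟩ := exists_isTraj hf hf0 (R := ‖φ‖ + 1) (by positivity)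
  have hδS : δ ∈ S := ⟨hδ, hex φ (by linarith)⟩
  set b : EReal := sSup ((fun T : ℝ => (T : EReal)) '' S) with hb
  have hlt : ∀ t : ℝ, (t : EReal) < b → ∃ T ∈ S, t < T := fun t ht => by
    obtain ⟨_, ⟨T, hT, rfl⟩, h⟩ := lt_sSup_iff.mp ht
    exact ⟨T, hT, EReal.coe_lt_coe_iff.mp h⟩
  have hle : ∀ T ∈ S, (T : EReal) ≤ b := fun T hT => le_sSup ⟨T, hT, rfl⟩
  set x : ℝ → Vec n := fun t =>
    if h : ∃ T ∈ S, t < T then h.choose_spec.1.2.choose t else 0 with hx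
  have hxz : ∀ T ∈ S, ∀ z, IsTraj Δ f φ T z → ∀ t ∈ Ico (-(Δ : ℝ)) T, x t = z t :=
    fun T hT z hz t ht => by
      have h : ∃ T ∈ S, t < T := ⟨T, hT, ht.2⟩
      simp only [hx, dif_pos h]
      have h1 := h.choose_spec.1.2.choose_spec
      have h2 := h.choose_spec.2
      exact (h1.mono (min_le_left _ T)).unique hf (hz.mono (min_le_right _ _))
        ⟨ht.1, le_min h2.le ht.2.le⟩
  have hloc : ∀ t : ℝ, (t : EReal) < b → ∃ T ∈ S, t < T ∧ ∃ z, IsTraj Δ f φ T z ∧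
      ∀ t ∈ Ico (-(Δ : ℝ)) T, x t = z t := fun t ht => by
    obtain ⟨T, hT, htT⟩ := hlt t ht
    obtain ⟨z, hz⟩ := hT.2
    exact ⟨T, hT, htT, z, hz, hxz T hT z hz⟩
  have hsol : IsSolution₀ Δ f φ b x := by
    have hseg : ∀ {T : ℝ} {z : ℝ → Vec n}, (∀ t ∈ Ico (-(Δ : ℝ)) T, x t = z t) →
        ∀ {t : ℝ}, 0 ≤ t → t < T → seg Δ x t = seg Δ z t := fun h t h0 ht =>
      seg_congr fun s hs => h s ⟨by linarith [hs.1], hs.2.trans_lt ht⟩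
    have h0b : (0 : EReal) < b :=
      lt_of_lt_of_le (by exact_mod_cast hδ : (0 : EReal) < (δ : EReal)) (hle δ hδS)
    refine ⟨h0b, fun t ht => ?_, fun τ => ?_, fun t h0 ht => ?_, fun t h0 ht => ?_⟩
    · obtain ⟨T, hT, htT, z, hz, hxz⟩ := hloc t ht.2
      refine (hz.cont.continuousAt.continuousWithinAt (s := {s | -(Δ : ℝ) ≤ s ∧ (s : EReal) < b})
        ).congr_of_eventuallyEq ?_ (hxz t ⟨ht.1, htT⟩)
      filter_upwards [self_mem_nhdsWithin, mem_nhdsWithin_of_mem_nhds (Iio_mem_nhds htT)]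
        with s hs1 hs2
      exact hxz s ⟨hs1.1, hs2⟩
    · obtain ⟨T, hT, htT, z, hz, hxz⟩ := hloc 0 h0b
      rw [hxz _ ⟨τ.2.1, τ.2.2.trans_lt htT⟩]
      exact hz.init τ
    · obtain ⟨T, hT, htT, z, hz, hxz⟩ := hloc t ht
      refine ((hz.continuous_rhs hf).intervalIntegrable 0 t).congr fun s hs => ?_
      rw [uIoc_of_le h0] at hs
      rw [hseg hxz hs.1.le (hs.2.trans_lt htT)]
    · obtain ⟨T, hT, htT, z, hz, hxz⟩ := hloc t ht
      rw [hxz t ⟨by linarith [Δ.coe_nonneg], htT⟩,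
        hxz 0 ⟨by linarith [Δ.coe_nonneg], h0.trans_lt htT⟩, hz.integral_eq t ⟨h0, htT.le⟩]
      congr 1
      refine intervalIntegral.integral_congr fun s hs => ?_
      rw [uIcc_of_le h0] at hs
      rw [hseg hxz hs.1 (hs.2.trans_lt htT)]
  refine ⟨b, x, hsol, fun b' x' hx' _ => ?_⟩
  refine EReal.ge_of_forall_gt_iff_ge.mp fun t ht => ?_
  by_cases h0 : 0 < t
  · obtain ⟨z, hz, -⟩ := IsSolution.exists_isTraj hx' h0.le ht
    exact hle t ⟨h0, z, hz⟩
  · push Not at h0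
    exact (by exact_mod_cast h0 : (t : EReal) ≤ 0).trans hsol.tmax_pos.le

end Existence

section Driver

variable {Δ : ℝ≥0} {n : ℕ} {f : Hist Δ n → Vec n}

/-- Along a trajectory, the true history and its first-order deformation agree to first order. -/
theorem IsTraj.eventually_norm_seg_sub_shiftSeg_le (hf : LipOnBounded₀ f) {φ : Hist Δ n} {T : ℝ}
    {x : ℝ → Vec n} (hx : IsTraj Δ f φ T x) {t : ℝ} (ht : t ∈ Ico 0 T) {ε : ℝ} (hε : 0 < ε) :
    ∀ᶠ h in 𝓝[>] (0 : ℝ),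
      ‖seg Δ x (t + h) - shiftSeg (seg Δ x t) (f (seg Δ x t)) h‖ ≤ ε * h := by
  set g : ℝ → Vec n := fun s => f (seg Δ x s) with hg
  have hgc : Continuous g := hx.continuous_rhs hf
  obtain ⟨η, hη, hgη⟩ := Metric.continuousAt_iff.mp (hgc.continuousAt (x := t)) ε hε
  filter_upwards [Ioo_mem_nhdsGT (lt_min hη (sub_pos.mpr ht.2))] with h hh
  have hh1 : h < η := hh.2.trans_le (min_le_left _ _)
  have hh2 : h < T - t := hh.2.trans_le (min_le_right _ _)
  have hh0 : 0 < h := hh.1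
  rw [ContinuousMap.norm_le _ (by positivity)]
  intro τ
  rw [ContinuousMap.sub_apply, seg_apply_of_continuous hx.cont]
  simp only [shiftSeg, ContinuousMap.coe_mk]
  rw [seg_apply_of_continuous hx.cont]
  by_cases hτ : τ.1 + h ≤ 0
  · rw [projIcc_of_mem _ ⟨by linarith [τ.2.1], hτ⟩, max_eq_right (by linarith)]
    have : t + h + τ.1 = t + (τ.1 + h) := by ring
    simp only [this, zero_smul, add_zero, sub_self, norm_zero]
    positivity
  · push Not at hτ
    have hτ0 := τ.2.2
    rw [projIcc_of_right_le _ hτ.le, max_eq_left (by linarith)]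
    set k := h + τ.1 with hk
    have hk0 : 0 < k := by linarith
    have hkh : k ≤ h := by linarith
    have h1 : t + h + τ.1 = t + k := by rw [hk]; ring
    have h2 := hx.sub_eq hf (s := t) (t := t + k) ⟨ht.1, ht.2.le⟩
      ⟨by linarith [ht.1], by linarith⟩
    have h3 : ∫ r in t..(t + k), (g r - g t) = x (t + k) - x t - k • g t := by
      rw [intervalIntegral.integral_sub (hgc.intervalIntegrable _ _) (by simp),
        intervalIntegral.integral_const, ← h2, add_sub_cancel_left]
    rw [h1, add_zero, ← sub_sub, ← h3]
    have := intervalIntegral.norm_integral_le_of_norm_le_const (a := t) (b := t + k)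
      (C := ε) (f := fun r => g r - g t) fun r hr => by
        rw [uIoc_of_le (by linarith)] at hr
        rw [← dist_eq_norm]
        refine (hgη ?_).le
        rw [Real.dist_eq, abs_of_nonneg (by linarith [hr.1])]
        linarith [hr.2]
    rw [add_sub_cancel_left, abs_of_pos hk0] at this
    exact this.trans (by gcongr)

theorem IsTraj.eventually_abs_sub_shiftSeg_le (hf : LipOnBounded₀ f) {φ : Hist Δ n} {T : ℝ}
    {x : ℝ → Vec n} (hx : IsTraj Δ f φ T x) {V : Hist Δ n → ℝ} (hV : LipOnBoundedV V)
    {t : ℝ} (ht : t ∈ Ico 0 T) {ε : ℝ} (hε : 0 < ε) :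
    ∀ᶠ h in 𝓝[>] (0 : ℝ),
      |V (seg Δ x (t + h)) - V (shiftSeg (seg Δ x t) (f (seg Δ x t)) h)| ≤ ε * h := by
  obtain ⟨L, hL, hVL⟩ := hV (‖seg Δ x t‖ + 2) (by positivity)
  have hc : Tendsto (fun h => ‖seg Δ x (t + h)‖) (𝓝[>] 0) (𝓝 ‖seg Δ x t‖) := by
    have : Continuous fun h => ‖seg Δ x (t + h)‖ :=
      ((continuous_seg (Δ := Δ) hx.cont).comp (continuous_const.add continuous_id)).norm
    have := this.tendsto 0
    rw [add_zero] at this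
    exact this.mono_left nhdsWithin_le_nhds
  filter_upwards [hx.eventually_norm_seg_sub_shiftSeg_le hf ht (div_pos hε hL),
    hx.eventually_norm_seg_sub_shiftSeg_le hf ht one_pos, hc.eventually_le_const
      (lt_add_one _), Ioo_mem_nhdsGT (one_pos (α := ℝ))] with h h1 h2 h3 h4
  have h5 : ‖shiftSeg (seg Δ x t) (f (seg Δ x t)) h‖ ≤ ‖seg Δ x t‖ + 2 := by
    have := norm_le_insert (seg Δ x (t + h)) (shiftSeg (seg Δ x t) (f (seg Δ x t)) h)
    linarith [h4.2]
  calc _ ≤ L * ‖seg Δ x (t + h) - shiftSeg (seg Δ x t) (f (seg Δ x t)) h‖ :=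
        hVL _ _ (by linarith) h5
    _ ≤ L * (ε / L * h) := by gcongr
    _ = ε * h := by field_simp

/-- A Driver-derivative bound controls the difference quotients along the trajectory. -/
theorem IsTraj.eventually_slope_lt (hf : LipOnBounded₀ f) {φ : Hist Δ n} {T : ℝ}
    {x : ℝ → Vec n} (hx : IsTraj Δ f φ T x) {V : Hist Δ n → ℝ} (hV : LipOnBoundedV V)
    {t : ℝ} (ht : t ∈ Ico 0 T) {a r : ℝ}
    (ha : driverD V (seg Δ x t) (f (seg Δ x t)) ≤ (a : EReal)) (har : a < r) :
    ∀ᶠ z in 𝓝[>] t, slope (fun s => V (seg Δ x s)) t z < r := by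
  have h1 : driverD V (seg Δ x t) (f (seg Δ x t)) < (((a + r) / 2 : ℝ) : EReal) :=
    ha.trans_lt (by exact_mod_cast (by linarith : a < (a + r) / 2))
  have h2 := eventually_lt_of_limsup_lt h1
  have h3 := hx.eventually_abs_sub_shiftSeg_le hf hV ht (show 0 < (r - a) / 2 by linarith)
  have h4 : ∀ᶠ h in 𝓝[>] (0 : ℝ), slope (fun s => V (seg Δ x s)) t (t + h) < r := by
    filter_upwards [h2, h3, self_mem_nhdsWithin] with h h2 h3 hh
    have hh : 0 < h := hh
    have h2 : (V (shiftSeg (seg Δ x t) (f (seg Δ x t)) h) - V (seg Δ x t)) / h < (a + r) / 2 := by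
      exact_mod_cast h2
    rw [div_lt_iff₀ hh] at h2
    rw [slope_def_field, add_sub_cancel_left, div_lt_iff₀ hh]
    nlinarith [(abs_le.mp h3).2]
  have h5 : Tendsto (fun z => z - t) (𝓝[>] t) (𝓝[>] 0) := by
    refine tendsto_nhdsWithin_iff.mpr ⟨?_, ?_⟩
    · have : Continuous fun z : ℝ => z - t := by fun_prop
      have := this.tendsto t
      rw [sub_self] at this
      exact this.mono_left nhdsWithin_le_nhds
    · filter_upwards [self_mem_nhdsWithin] with z hz
      exact sub_pos.mpr (mem_Ioi.mp hz)
  filter_upwards [h5.eventually h4] with z hz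
  rwa [add_sub_cancel] at hz

/-- If `V` decays exponentially along trajectories, then its Driver derivative is at most `-V`. -/
theorem IsTraj.driverD_le_neg (hf : LipOnBounded₀ f) {φ : Hist Δ n} {T : ℝ} (hT : 0 < T)
    {x : ℝ → Vec n} (hx : IsTraj Δ f φ T x) {V : Hist Δ n → ℝ} (hV : LipOnBoundedV V)
    (hdec : ∀ h ∈ Icc 0 T, V (seg Δ x h) ≤ Real.exp (-h) * V φ) :
    driverD V φ (f φ) ≤ ((-V φ : ℝ) : EReal) := by
  refine EReal.le_of_forall_lt_iff_le.mp fun r hr => ?_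
  have hr : -V φ < r := by exact_mod_cast hr
  refine limsup_le_of_le (h := ?_)
  have h1 := hx.eventually_abs_sub_shiftSeg_le hf hV ⟨le_rfl, hT⟩
    (show 0 < (r + V φ) / 2 by linarith)
  simp only [hx.seg_zero, zero_add] at h1
  have hd : HasDerivAt (fun h : ℝ => Real.exp (-h) * V φ) (-V φ) 0 := by
    have := ((hasDerivAt_neg (0 : ℝ)).exp).mul_const (V φ)
    simpa using this
  have h2 := (hd.tendsto_slope.mono_left (nhdsWithin_mono 0 fun z (hz : z ∈ Ioi 0) => ne_of_gt hz)
    ).eventually_lt_const (show -V φ < (r - V φ) / 2 by linarith)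
  filter_upwards [h1, h2, Ioo_mem_nhdsGT hT] with h h1 h2 ⟨hh, hhT⟩
  rw [slope_def_field, sub_zero, div_lt_iff₀ hh] at h2
  simp only [neg_zero, Real.exp_zero, one_mul] at h2
  norm_cast
  rw [div_le_iff₀ hh]
  nlinarith [(abs_le.mp h1).1, hdec h ⟨hh.le, hhT.le⟩]

end Driver

section ComparisonFunctions

theorem ClassK.nonneg {α : ℝ → ℝ} (h : ClassK α) {s : ℝ} (hs : 0 ≤ s) : 0 ≤ α s :=
  h.2.2 ▸ h.2.1.monotoneOn self_mem_Ici hs hs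

theorem ClassK.pos {α : ℝ → ℝ} (h : ClassK α) {s : ℝ} (hs : 0 < s) : 0 < α s :=
  h.2.2 ▸ h.2.1 self_mem_Ici hs.le hs

theorem ClassK.classP {α : ℝ → ℝ} (h : ClassK α) : ClassP α :=
  ⟨h.1, h.2.2, fun _ hs => h.pos hs⟩

theorem ClassP.nonneg {α : ℝ → ℝ} (h : ClassP α) {s : ℝ} (hs : 0 ≤ s) : 0 ≤ α s := by
  rcases hs.eq_or_lt with rfl | hs
  · exact h.2.1.ge
  · exact (h.2.2 s hs).le

theorem ClassK.exists_forall_le {α : ℝ → ℝ} (h : ClassK α) {ε : ℝ} (hε : 0 < ε) :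
    ∃ δ : ℝ, 0 < δ ∧ ∀ s ∈ Icc 0 δ, α s ≤ ε := by
  have h1 := (h.1 0 self_mem_Ici).eventually_le_const (h.2.2.trans_lt hε)
  obtain ⟨δ, hδ, hδ'⟩ := (mem_nhdsGE_iff_exists_Icc_subset).mp h1
  exact ⟨δ, hδ, fun s hs => hδ' hs⟩

/-- Uniform boundedness, stability and attractivity of a family of scalar data `A ρ s v`
(initial size `ρ`, time `s`, value `v`) yield a common class-`𝒦ℒ` bound. -/
theorem exists_classKL_bound {A : ℝ → ℝ → ℝ → Prop}
    (hbdd : ∀ r, ∃ M : ℝ, ∀ ρ s v, ρ ≤ r → A ρ s v → v ≤ M)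
    (hstab : ∀ ε : ℝ, 0 < ε → ∃ δ : ℝ, 0 < δ ∧ ∀ ρ s v, ρ ≤ δ → A ρ s v → v ≤ ε)
    (hattr : ∀ r ε : ℝ, 0 < ε → ∃ T : ℝ, ∀ ρ s v, ρ ≤ r → T ≤ s → A ρ s v → v ≤ ε) :
    ∃ β : ℝ → ℝ → ℝ, ClassKL β ∧ ∀ ρ s v, 0 ≤ ρ → 0 ≤ s → A ρ s v → v ≤ β ρ s := by
  set B : ℝ → ℝ → Set ℝ := fun r t => insert 0 {v | ∃ ρ s, ρ ≤ r ∧ t ≤ s ∧ A ρ s v} with hB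
  set ψ : ℝ → ℝ → ℝ := fun r t => sSup (B r t) with hψ
  have hBb : ∀ r t, BddAbove (B r t) := fun r t => by
    obtain ⟨M, hM⟩ := hbdd r
    refine (bddAbove_insert (a := (0 : ℝ))).mpr ⟨M, ?_⟩
    rintro v ⟨ρ, s, hρ, -, hA⟩
    exact hM ρ s v hρ hA
  have hψ0 : ∀ r t, 0 ≤ ψ r t := fun r t => le_csSup (hBb r t) (mem_insert _ _)
  have hψle : ∀ r t ε, 0 ≤ ε → (∀ ρ s v, ρ ≤ r → t ≤ s → A ρ s v → v ≤ ε) → ψ r t ≤ ε :=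
    fun r t ε hε h => csSup_le ⟨0, mem_insert _ _⟩ (by
      rintro v (rfl | ⟨ρ, s, hρ, hs, hA⟩)
      · exact hε
      · exact h ρ s v hρ hs hA)
  have hψA : ∀ ρ s v, A ρ s v → v ≤ ψ ρ s := fun ρ s v h =>
    le_csSup (hBb ρ s) (mem_insert_of_mem _ ⟨ρ, s, le_rfl, le_rfl, h⟩)
  have hψmono : ∀ t, Monotone fun r => ψ r t := fun t r r' h =>
    csSup_le_csSup (hBb r' t) ⟨0, mem_insert _ _⟩
      (insert_subset_insert fun v ⟨ρ, s, hρ, hs, hA⟩ => ⟨ρ, s, hρ.trans h, hs, hA⟩)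
  have hψanti : ∀ r, Antitone (ψ r) := fun r t t' h =>
    csSup_le_csSup (hBb r t) ⟨0, mem_insert _ _⟩
      (insert_subset_insert fun v ⟨ρ, s, hρ, hs, hA⟩ => ⟨ρ, s, hρ, h.trans hs, hA⟩)
  have hupper : ∀ {g : ℝ → ℝ}, Monotone g ∨ Antitone g → ∀ {a b c : ℝ}, a ≤ b →
      (∀ u ∈ Icc a b, g u ≤ c) → ∫ u in a..b, g u ≤ c * (b - a) := fun hg a b c hab h => by
    have := intervalIntegral.integral_mono_on hab
      (hg.elim (fun h => h.intervalIntegrable) fun h => h.intervalIntegrable)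
      (intervalIntegrable_const (μ := volume) (c := c)) h
    rwa [intervalIntegral.integral_const, smul_eq_mul, mul_comm] at this
  have hlower : ∀ {g : ℝ → ℝ}, Monotone g ∨ Antitone g → ∀ {a b c : ℝ}, a ≤ b →
      (∀ u ∈ Icc a b, c ≤ g u) → c * (b - a) ≤ ∫ u in a..b, g u := fun hg a b c hab h => by
    have := intervalIntegral.integral_mono_on hab
      (intervalIntegrable_const (μ := volume) (c := c))
      (hg.elim (fun h => h.intervalIntegrable) fun h => h.intervalIntegrable) h
    rwa [intervalIntegral.integral_const, smul_eq_mul, mul_comm] at this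
  -- regularization in time
  set χ : ℝ → ℝ → ℝ := fun r t => ∫ v in (t - 1)..t, ψ r v with hχ
  have hχcont : ∀ r, Continuous (χ r) := fun r => by
    have hi : ∀ a b, IntervalIntegrable (ψ r) volume a b := fun a b =>
      (hψanti r).intervalIntegrable
    have : χ r = fun t => (∫ v in (0 : ℝ)..t, ψ r v) - ∫ v in (0 : ℝ)..(t - 1), ψ r v := by
      funext t
      rw [intervalIntegral.integral_interval_sub_left (hi _ _) (hi _ _)]
    rw [this]
    have hc := intervalIntegral.continuous_primitive hi 0
    exact hc.sub (hc.comp (continuous_id.sub continuous_const))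
  have hχle : ∀ r t, χ r t ≤ ψ r (t - 1) := fun r t => by
    have := hupper (Or.inr (hψanti r)) (sub_le_self t zero_le_one) fun u hu => hψanti r hu.1
    simpa using this
  have hχge : ∀ r t, ψ r t ≤ χ r t := fun r t => by
    have := hlower (Or.inr (hψanti r)) (sub_le_self t zero_le_one) fun u hu => hψanti r hu.2
    simpa using this
  have hχ0 : ∀ r t, 0 ≤ χ r t := fun r t => (hψ0 r t).trans (hχge r t)
  have hχmono : ∀ t, Monotone fun r => χ r t := fun t r r' h =>
    intervalIntegral.integral_mono_on (sub_le_self t zero_le_one) (hψanti r).intervalIntegrable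
      (hψanti r').intervalIntegrable fun v _ => hψmono v h
  have hχanti : ∀ r, Antitone (χ r) := fun r t t' h => by
    have e : ∀ t, χ r t = ∫ v in (0 : ℝ)..1, ψ r (v + (t - 1)) := fun t => by
      rw [intervalIntegral.integral_comp_add_right]
      simp [hχ]
    have hi : ∀ t, IntervalIntegrable (fun v => ψ r (v + (t - 1))) volume 0 1 := fun t =>
      Antitone.intervalIntegrable fun a b hab => hψanti r (by linarith)
    rw [e, e]
    exact intervalIntegral.integral_mono_on zero_le_one (hi _) (hi _) fun v _ =>
      hψanti r (by linarith)
  -- regularization in the initial size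
  set κ : ℝ → ℝ → ℝ := fun r t => ∫ u in (1 : ℝ)..2, χ (r * u) t with hκ
  have hm : ∀ r t, 0 ≤ r → Monotone fun u => χ (r * u) t := fun r t hr u u' h =>
    hχmono t (mul_le_mul_of_nonneg_left h hr)
  have hκle : ∀ r t, 0 ≤ r → κ r t ≤ χ (r * 2) t := fun r t hr => by
    have := hupper (Or.inl (hm r t hr)) one_le_two fun u hu => hm r t hr hu.2
    norm_num at this
    exact this
  have hκge : ∀ r t, 0 ≤ r → χ r t ≤ κ r t := fun r t hr => by
    have := hlower (Or.inl (hm r t hr)) one_le_two fun u hu => hm r t hr hu.1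
    norm_num at this
    exact this
  have hκ0 : ∀ r t, 0 ≤ r → 0 ≤ κ r t := fun r t hr => (hχ0 r t).trans (hκge r t hr)
  have hκmono : ∀ r r' t, 0 ≤ r → r ≤ r' → κ r t ≤ κ r' t := fun r r' t hr h =>
    intervalIntegral.integral_mono_on one_le_two (hm r t hr).intervalIntegrable
      (hm r' t (hr.trans h)).intervalIntegrable fun u hu =>
        hχmono t (mul_le_mul_of_nonneg_right h (by linarith [hu.1]))
  have hκanti : ∀ r, 0 ≤ r → Antitone (κ r) := fun r hr t t' h =>
    intervalIntegral.integral_mono_on one_le_two (hm r t' hr).intervalIntegrable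
      (hm r t hr).intervalIntegrable fun u _ => hχanti _ h
  have hκsmall : ∀ ε : ℝ, 0 < ε → ∃ δ : ℝ, 0 < δ ∧ ∀ r t, 0 ≤ r → r ≤ δ → κ r t ≤ ε :=
    fun ε hε => by
      obtain ⟨δ, hδ, h⟩ := hstab ε hε
      refine ⟨δ / 2, by positivity, fun r t hr hrδ => (hκle r t hr).trans ((hχle _ _).trans ?_)⟩
      exact hψle _ _ _ hε.le fun ρ s v hρ _ hA => h ρ s v (by linarith) hA
  have hκzero : ∀ t, κ 0 t = 0 := fun t => le_antisymm (le_of_forall_pos_le_add fun ε hε => by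
    obtain ⟨δ, hδ, h⟩ := hκsmall ε hε
    simpa using h 0 t le_rfl hδ.le) (hκ0 0 t le_rfl)
  have hκcont1 : ∀ t, ContinuousOn (fun r => κ r t) (Ici 0) := fun t r hr => by
    rcases (mem_Ici.mp hr).eq_or_lt with rfl | hr
    · rw [Metric.continuousWithinAt_iff]
      intro ε hε
      obtain ⟨δ, hδ, h⟩ := hκsmall (ε / 2) (by positivity)
      refine ⟨δ, hδ, fun {r} hr hrδ => ?_⟩
      rw [Real.dist_eq, sub_zero, abs_of_nonneg hr] at hrδ
      rw [Real.dist_eq, hκzero, sub_zero, abs_of_nonneg (hκ0 r t hr)]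
      linarith [h r t hr hrδ.le]
    · refine ContinuousAt.continuousWithinAt ?_
      have hi : ∀ a b, IntervalIntegrable (fun v => χ v t) volume a b := fun a b =>
        (hχmono t).intervalIntegrable
      have hc := intervalIntegral.continuous_primitive hi 0
      have h1 : ContinuousAt (fun r : ℝ =>
          r⁻¹ * ((∫ v in (0 : ℝ)..(r * 2), χ v t) - ∫ v in (0 : ℝ)..(r * 1), χ v t)) r :=
        (continuousAt_inv₀ hr.ne').mul
          ((hc.comp (continuous_id.mul continuous_const)).sub
            (hc.comp (continuous_id.mul continuous_const))).continuousAt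
      refine h1.congr ?_
      filter_upwards [Ioi_mem_nhds hr] with r hr
      rw [intervalIntegral.integral_interval_sub_left (hi _ _) (hi _ _), hκ]
      simp only
      rw [intervalIntegral.integral_comp_mul_left (fun v => χ v t) (ne_of_gt hr), smul_eq_mul]
  have hκcont2 : ∀ r, 0 ≤ r → ContinuousOn (κ r) (Ici 0) := fun r hr => by
    rw [continuousOn_iff_continuous_domRestrict]
    refine intervalIntegral.continuous_of_dominated_interval (bound := fun _ => χ (r * 2) 0)
      (fun t => (hm r t hr).measurable.aestronglyMeasurable) (fun t => ae_of_all _ fun u hu => ?_)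
      intervalIntegrable_const (ae_of_all _ fun u _ =>
        (hχcont _).comp continuous_subtype_val)
    rw [uIoc_of_le one_le_two] at hu
    rw [Real.norm_of_nonneg (hχ0 _ _)]
    exact (hm r t.1 hr hu.2).trans (hχanti _ t.2)
  refine ⟨fun r t => κ r t + r * Real.exp (-t), ⟨fun t _ => ⟨?_, ?_, ?_⟩, fun r hr => ⟨?_, ?_, ?_⟩⟩,
    fun ρ s v hρ hs hA => ?_⟩
  · exact (hκcont1 t).add (by fun_prop)
  · intro r hr r' _ h
    exact add_lt_add_of_le_of_lt (hκmono r r' t hr h.le)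
      (mul_lt_mul_of_pos_right h (Real.exp_pos _))
  · simp [hκzero]
  · exact (hκcont2 r hr).add (by fun_prop)
  · intro t _ t' _ h
    have := hκanti r hr h
    simp only
    gcongr
  · have h1 : Tendsto (κ r) atTop (𝓝 0) := by
      rw [Metric.tendsto_atTop]
      intro ε hε
      obtain ⟨T, hT⟩ := hattr (r * 2) (ε / 2) (by positivity)
      refine ⟨T + 1, fun t ht => ?_⟩
      rw [Real.dist_eq, sub_zero, abs_of_nonneg (hκ0 r t hr)]
      have h2 : ψ (r * 2) (t - 1) ≤ ε / 2 := hψle _ _ _ (by positivity) fun ρ s v hρ hs hA =>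
        hT ρ s v hρ (by linarith) hA
      linarith [hκle r t hr, hχle (r * 2) t]
    have h2 : Tendsto (fun t => r * Real.exp (-t)) atTop (𝓝 (r * 0)) :=
      (Real.tendsto_exp_neg_atTop_nhds_zero).const_mul r
    simpa using h1.add h2
  · have h1 := (hψA ρ s v hA).trans ((hχge ρ s).trans (hκge ρ s hρ))
    have h2 : 0 ≤ ρ * Real.exp (-s) := by positivity
    linarith

end ComparisonFunctions

section Sufficiency

variable {Δ : ℝ≥0} {n : ℕ} {f : Hist Δ n → Vec n}

theorem IsTraj.le_sub_of_driverD_le (hf : LipOnBounded₀ f) {φ : Hist Δ n} {T : ℝ}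
    {x : ℝ → Vec n} (hx : IsTraj Δ f φ T x) {V : Hist Δ n → ℝ} (hV : LipOnBoundedV V)
    {a b c : ℝ} (ha : 0 ≤ a) (hab : a ≤ b) (hb : b ≤ T)
    (h : ∀ t ∈ Ico a b, driverD V (seg Δ x t) (f (seg Δ x t)) ≤ ((-c : ℝ) : EReal)) :
    V (seg Δ x b) ≤ V (seg Δ x a) - c * (b - a) := by
  have hVc : Continuous fun t => V (seg Δ x t) := by
    refine continuous_iff_continuousAt.mpr fun t => ?_
    obtain ⟨L, hL, hVL⟩ := hV (‖seg Δ x t‖ + 1) (by positivity)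
    have hs := (continuous_seg (Δ := Δ) hx.cont).continuousAt (x := t)
    refine tendsto_iff_norm_sub_tendsto_zero.mpr ?_
    have h1 : Tendsto (fun s => L * ‖seg Δ x s - seg Δ x t‖) (𝓝 t) (𝓝 0) := by
      simpa using (tendsto_iff_norm_sub_tendsto_zero.mp hs).const_mul L
    refine squeeze_zero' (Eventually.of_forall fun _ => norm_nonneg _) ?_ h1
    filter_upwards [hs.norm.eventually_le_const (lt_add_one _)] with s hs
    exact hVL _ _ hs (by linarith)
  have := image_le_of_liminf_slope_right_le_deriv_boundary (f := fun t => V (seg Δ x t))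
    (a := a) (b := b) hVc.continuousOn (B := fun t => V (seg Δ x a) - c * (t - a))
    (B' := fun _ => -c) (by simp) (by fun_prop)
    (fun t _ => by
      have := ((((hasDerivAt_id t).sub_const a).const_mul c).const_sub (V (seg Δ x a)))
      simpa using this.hasDerivWithinAt)
    (fun t ht r hr => (hx.eventually_slope_lt hf hV ⟨ha.trans ht.1, ht.2.trans_le hb⟩
      (h t ht) hr).frequently)
  exact this ⟨hab, le_rfl⟩

/-- An LKF whose dissipation is, on each bounded set, a positive definite function of `|φ(0)|`. -/
def HasPointwiseLKF (Δ : ℝ≥0) {n : ℕ} (f : Hist Δ n → Vec n) : Prop :=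
  ∃ V : Hist Δ n → ℝ, IsLKF V ∧ ∀ M : ℝ, 0 < M → ∃ α : ℝ → ℝ, ClassP α ∧
    ∀ φ : Hist Δ n, ‖φ‖ ≤ M → driverD V φ (f φ) ≤ ((-α ‖ev0 φ‖ : ℝ) : EReal)

theorem HasPointwiseLKF.gas (hf : LipOnBounded₀ f) (hf0 : f 0 = 0) (h : HasPointwiseLKF Δ f) :
    GAS Δ f := by
  obtain ⟨V, ⟨hV0, hVL, α₁, α₂, hα₁, hα₂, hV⟩, hdiss⟩ := h
  have hdec : ∀ {φ T x}, IsTraj Δ f φ T x → ∀ {s t}, 0 ≤ s → s ≤ t → t ≤ T →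
      V (seg Δ x t) ≤ V (seg Δ x s) := fun {φ T x} hx {s t} hs hst ht => by
    obtain ⟨M, hM, hxM⟩ := hx.exists_norm_seg_le
    obtain ⟨α, hα, hd⟩ := hdiss M hM
    have := hx.le_sub_of_driverD_le hf hVL (c := 0) hs hst ht fun r hr => by
      refine (hd _ (hxM r ⟨hs.trans hr.1, hr.2.le.trans ht⟩)).trans ?_
      exact_mod_cast neg_le_neg (hα.nonneg (norm_nonneg _))
    linarith
  have hst : ∀ {φ T x}, IsTraj Δ f φ T x → ∀ {s t}, 0 ≤ s → s ≤ t → t ≤ T →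
      α₁ ‖x t‖ ≤ α₂ ‖seg Δ x s‖ := fun {φ T x} hx {s t} hs hst ht => by
    rw [← ev0_seg (Δ := Δ) hx.cont]
    exact (hV _).1.trans ((hdec hx hs hst ht).trans (hV _).2)
  have hα₁le : ∀ {a b : ℝ}, 0 ≤ a → 0 ≤ b → α₁ a ≤ α₁ b → a ≤ b := fun ha hb h =>
    (hα₁.1.2.1.le_iff_le ha hb).mp h
  have hbound : ∀ r : ℝ, ∃ M : ℝ, 0 < M ∧ ∀ φ T x, ‖φ‖ ≤ r → IsTraj Δ f φ T x →
      ∀ t ∈ Icc 0 T, ‖seg Δ x t‖ ≤ M := fun r => by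
    obtain ⟨M, hM⟩ := ((hα₁.2.eventually_ge_atTop (α₂ (max r 0))).and
      (eventually_ge_atTop 0)).exists
    refine ⟨max (max M r) 1, by positivity, fun φ T x hφ hx t ht => ?_⟩
    refine norm_seg_le hx.cont (by positivity) fun s hs => (?_ : ‖x s‖ ≤ max M r).trans
      (le_max_left _ _)
    by_cases hs0 : 0 ≤ s
    · refine (hα₁le (norm_nonneg _) hM.2 ?_).trans (le_max_left _ _)
      refine (hst hx le_rfl hs0 (hs.2.trans ht.2)).trans (le_trans ?_ hM.1)
      rw [hx.seg_zero]
      exact hα₂.1.2.1.monotoneOn (norm_nonneg _) (le_max_right r 0) (hφ.trans (le_max_left _ _))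
    · push Not at hs0
      rw [hx.init ⟨s, by linarith [hs.1, ht.1], hs0.le⟩]
      exact (φ.norm_coe_le_norm _).trans (hφ.trans (le_max_right _ _))
  have hstab : ∀ ε : ℝ, 0 < ε → ∃ δ : ℝ, 0 < δ ∧ ∀ φ T x, IsTraj Δ f φ T x →
      ∀ s t, 0 ≤ s → s ≤ t → t ≤ T → ‖seg Δ x s‖ ≤ δ → ‖x t‖ ≤ ε := fun ε hε => by
    obtain ⟨δ, hδ, h⟩ := hα₂.1.exists_forall_le (hα₁.1.pos hε)
    exact ⟨δ, hδ, fun φ T x hx s t h0 h1 h2 hs => hα₁le (norm_nonneg _) hε.le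
      ((hst hx h0 h1 h2).trans (h _ ⟨norm_nonneg _, hs⟩))⟩
  have hattr : ∀ r ε : ℝ, 0 < ε → ∃ S : ℝ, 0 ≤ S ∧ ∀ φ T x, ‖φ‖ ≤ r → IsTraj Δ f φ T x →
      ∀ t, S ≤ t → t ≤ T → ‖x t‖ ≤ ε := fun r ε hε => by
    obtain ⟨δ, hδ, hδs⟩ := hstab ε hε
    obtain ⟨M, hM, hMb⟩ := hbound r
    obtain ⟨L, hL, hfL⟩ := hf M hM
    obtain ⟨α, hα, hd⟩ := hdiss M hM
    obtain ⟨s₀, hs₀, hmin⟩ := (isCompact_Icc (a := δ / 2) (b := max M δ)).exists_isMinOn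
      (nonempty_Icc.mpr ((half_le_self hδ.le).trans (le_max_right _ _)))
      (hα.1.mono fun s hs => (half_pos hδ).le.trans hs.1)
    set c := α s₀ with hc
    have hc0 : 0 < c := hα.2.2 s₀ ((half_pos hδ).trans_le hs₀.1)
    set η := min 1 (δ / (2 * (L * M))) with hη
    have hη0 : 0 < η := by positivity
    have hη1 : η ≤ 1 := min_le_left _ _
    have hη2 : L * M * η ≤ δ / 2 := by
      calc _ ≤ L * M * (δ / (2 * (L * M))) := by gcongr; exact min_le_right _ _
        _ = δ / 2 := by field_simp
    obtain ⟨N, hN⟩ := exists_nat_gt (α₂ (max r 0) / (c * η))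
    rw [div_lt_iff₀ (by positivity)] at hN
    have hΔ := Δ.coe_nonneg
    set τ : ℝ := Δ + 1 with hτ
    refine ⟨N * τ, by positivity, fun φ T x hφ hx t hSt htT => ?_⟩
    by_contra hcon
    have hbig : ∀ s ∈ Icc 0 (N * τ), δ < ‖seg Δ x s‖ := fun s hs => by
      by_contra hle
      push Not at hle
      exact hcon (hδs φ T x hx s t hs.1 (hs.2.trans hSt) htT hle)
    have hxM : ∀ s ∈ Icc 0 T, ‖seg Δ x s‖ ≤ M := hMb φ T x hφ hx
    have key : ∀ j : ℕ, j ≤ N → V (seg Δ x (j * τ)) ≤ α₂ (max r 0) - j * (c * η) := by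
      intro j
      induction j with
      | zero =>
        intro _
        simp only [Nat.cast_zero, zero_mul, sub_zero, hx.seg_zero]
        exact (hV φ).2.trans (hα₂.1.2.1.monotoneOn (norm_nonneg _) (le_max_right r 0)
          (hφ.trans (le_max_left _ _)))
      | succ j ih =>
        intro hj
        have hj' := ih (by omega)
        have hjN : ((j : ℝ) + 1) * τ ≤ N * τ := by
          gcongr; exact_mod_cast hj
        have hj0 : 0 ≤ (j : ℝ) * τ := by positivity
        have he : ((j : ℝ) + 1) * τ = j * τ + Δ + 1 := by rw [hτ]; ring
        obtain ⟨s, hs, hsδ⟩ : ∃ s ∈ Icc (j * τ) (j * τ + Δ), δ < ‖x s‖ := by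
          by_contra hno
          push Not at hno
          refine (hbig (j * τ + Δ) ⟨by linarith, by linarith⟩).not_ge
            (norm_seg_le hx.cont hδ.le fun s hs => hno s ⟨by linarith [hs.1], hs.2⟩)
        have hs0 : 0 ≤ s := hj0.trans hs.1
        have hsη : s + η ≤ (j + 1) * τ := by linarith [hs.2]
        have h1 := hx.le_sub_of_driverD_le hf hVL (c := c) hs0 (by linarith : s ≤ s + η)
          (by linarith) fun q hq => by
            have hqT : q ∈ Icc 0 T := ⟨hs0.trans hq.1, by linarith [hq.2]⟩
            refine (hd _ (hxM q hqT)).trans ?_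
            rw [ev0_seg hx.cont]
            have h2 : ‖x q‖ ≤ M :=
              (norm_le_norm_seg (Δ := Δ) hx.cont ⟨by linarith, le_rfl⟩).trans (hxM q hqT)
            have h3 : ‖x q - x s‖ ≤ δ / 2 := by
              rw [hx.sub_eq hf ⟨hs0, hq.1.trans hqT.2⟩ hqT]
              refine (intervalIntegral.norm_integral_le_of_norm_le_const (C := L * M)
                fun p hp => ?_).trans ?_
              · rw [uIoc_of_le hq.1] at hp
                have hp' := hxM p ⟨hs0.trans hp.1.le, hp.2.trans hqT.2⟩
                exact (LipOnBounded₀.norm_le hf0 hM.le hfL hp').trans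
                  (mul_le_mul_of_nonneg_left hp' hL.le)
              · rw [abs_of_nonneg (by linarith [hq.1])]
                refine le_trans ?_ hη2
                gcongr
                linarith [hq.2]
            have h4 : δ / 2 ≤ ‖x q‖ := by
              have := norm_sub_norm_le (x s) (x q)
              rw [norm_sub_rev] at this
              linarith
            have h5 : c ≤ α ‖x q‖ := hmin ⟨h4, h2.trans (le_max_left _ _)⟩
            exact_mod_cast neg_le_neg h5
        have h2 := hdec hx hj0 hs.1 (by linarith)
        have h3 := hdec hx (by linarith) hsη (by linarith)
        push_cast
        rw [add_sub_cancel_left] at h1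
        linarith
    have := key N le_rfl
    linarith [hV0 (seg Δ x (N * τ))]
  set A : ℝ → ℝ → ℝ → Prop := fun ρ s v => ∃ (φ : Hist Δ n) (T : ℝ) (x : ℝ → Vec n),
    IsTraj Δ f φ T x ∧ s ∈ Icc 0 T ∧ ‖φ‖ = ρ ∧ ‖x s‖ = v with hA
  obtain ⟨β, hβ, hβA⟩ := exists_classKL_bound (A := A)
    (fun r => by
      obtain ⟨M, hM, h⟩ := hbound r
      refine ⟨M, ?_⟩
      rintro ρ s v hρ ⟨φ, T, x, hx, hs, rfl, rfl⟩
      exact (norm_le_norm_seg (Δ := Δ) hx.cont ⟨by linarith [Δ.coe_nonneg], le_rfl⟩).trans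
        (h φ T x hρ hx s hs))
    (fun ε hε => by
      obtain ⟨δ, hδ, h⟩ := hstab ε hε
      refine ⟨δ, hδ, ?_⟩
      rintro ρ s v hρ ⟨φ, T, x, hx, hs, rfl, rfl⟩
      exact h φ T x hx 0 s le_rfl hs.1 hs.2 (by rwa [hx.seg_zero]))
    (fun r ε hε => by
      obtain ⟨S, -, h⟩ := hattr r ε hε
      refine ⟨S, ?_⟩
      rintro ρ s v hρ hS ⟨φ, T, x, hx, hs, rfl, rfl⟩
      exact h φ T x hρ hx s hS hs.2)
  refine ⟨β, hβ, fun φ b x hx => ?_⟩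
  have hb : b = ⊤ := by
    obtain ⟨M, hM, h⟩ := hbound ‖φ‖
    exact IsMaxSolution.eq_top_of_bounded hf hf0 hx hM fun T z hT _ hz =>
      h φ T z le_rfl hz T ⟨hT, le_rfl⟩
  refine ⟨hb, fun t ht => ?_⟩
  obtain ⟨z, hz, hzx⟩ := IsSolution.exists_isTraj hx.1 ht (hb ▸ EReal.coe_lt_top t)
  rw [← hzx ⟨by linarith [Δ.coe_nonneg], le_rfl⟩]
  exact hβA _ _ _ (norm_nonneg _) ht ⟨φ, t, z, hz, ⟨ht, le_rfl⟩, rfl, rfl⟩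

end Sufficiency

section Converse

/-- Converse Lyapunov theorem for semiflows that are uniformly attractive and Lipschitz in the
initial state, both uniformly over bounded sets. -/
theorem exists_lyapunov_of_semiflow {E : Type*} [NormedAddCommGroup E] {S : ℝ → E → E}
    (hS0 : ∀ φ, S 0 φ = φ) (hSadd : ∀ t h φ, 0 ≤ t → 0 ≤ h → S t (S h φ) = S (t + h) φ)
    (hSz : ∀ t, 0 ≤ t → S t 0 = 0)
    (hLip : ∀ R T : ℝ, 0 < R → 0 ≤ T → ∃ L : ℝ, 0 ≤ L ∧ ∀ φ ψ, ‖φ‖ ≤ R → ‖ψ‖ ≤ R →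
      ∀ t ∈ Icc 0 T, ‖S t φ - S t ψ‖ ≤ L * ‖φ - ψ‖)
    (hattr : ∀ R ε : ℝ, 0 < R → 0 < ε → ∃ T : ℝ, 0 ≤ T ∧ ∀ φ, ‖φ‖ ≤ R → ∀ t, T ≤ t →
      ‖S t φ‖ ≤ ε) :
    ∃ V : E → ℝ, V 0 = 0 ∧ (∀ r : ℝ, 0 < r → ∃ L : ℝ, 0 < L ∧
        ∀ φ ψ, ‖φ‖ ≤ r → ‖ψ‖ ≤ r → |V φ - V ψ| ≤ L * ‖φ - ψ‖) ∧
      (∃ α, ClassKinf α ∧ ∀ φ, α ‖φ‖ ≤ V φ) ∧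
      ∀ h φ, 0 ≤ h → V (S h φ) ≤ Real.exp (-h) * V φ := by
  set e : ℕ → ℝ := fun k => 1 / ((k : ℝ) + 1) with he
  have he0 : ∀ k, 0 < e k := fun k => by positivity
  set g : ℕ → ℝ≥0 → E → ℝ := fun k t φ => max 0 (‖S t φ‖ - e k) * Real.exp t with hg
  set W : ℕ → E → ℝ := fun k φ => ⨆ t : ℝ≥0, g k t φ with hW
  have hg0 : ∀ k t φ, 0 ≤ g k t φ := fun k t φ => by positivity
  have hgz : ∀ k t, g k t 0 = 0 := fun k t => by
    simp [hg, hSz t t.2, (he0 k).le]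
  have hgL : ∀ k : ℕ, ∀ R : ℕ, ∃ L : ℝ, 0 ≤ L ∧ ∀ φ ψ, ‖φ‖ ≤ R → ‖ψ‖ ≤ R →
      ∀ t, g k t φ - g k t ψ ≤ L * ‖φ - ψ‖ := fun k R => by
    obtain ⟨T, hT, hTa⟩ := hattr (R + 1) (e k) (by positivity) (he0 k)
    obtain ⟨L, hL, hLip⟩ := hLip (R + 1) T (by positivity) hT
    refine ⟨L * Real.exp T, by positivity, fun φ ψ hφ hψ t => ?_⟩
    by_cases ht : (t : ℝ) ≤ T
    · have h1 := hLip φ ψ (by linarith) (by linarith) t ⟨t.2, ht⟩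
      have h2 : max 0 (‖S t φ‖ - e k) - max 0 (‖S t ψ‖ - e k) ≤ ‖S t φ - S t ψ‖ := by
        have h3 := norm_sub_norm_le (S t φ) (S t ψ)
        rw [sub_le_iff_le_add]
        refine max_le (by positivity) ?_
        linarith [le_max_right 0 (‖S t ψ‖ - e k)]
      simp only [hg]
      rw [← sub_mul]
      calc _ ≤ (L * ‖φ - ψ‖) * Real.exp t := by gcongr; exact h2.trans h1
        _ ≤ (L * ‖φ - ψ‖) * Real.exp T := by gcongr
        _ = _ := by ring
    · push Not at ht
      have h1 := hTa φ (by linarith) t ht.le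
      have h2 : g k t φ = 0 := by
        simp only [hg]
        rw [max_eq_left (by linarith), zero_mul]
      rw [h2]
      have := hg0 k t ψ
      have : 0 ≤ L * Real.exp T * ‖φ - ψ‖ := by positivity
      linarith
  choose ℓ hℓ0 hℓ using hgL
  have hnat : ∀ φ : E, ∃ R : ℕ, ‖φ‖ ≤ R := fun φ => exists_nat_ge ‖φ‖
  have hgle : ∀ k R φ, ‖φ‖ ≤ (R : ℕ) → ∀ t, g k t φ ≤ ℓ k R * ‖φ‖ := fun k R φ hφ t => by
    simpa [hgz] using hℓ k R φ 0 hφ (by simp) t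
  have hgb : ∀ k φ, BddAbove (range fun t => g k t φ) := fun k φ => by
    obtain ⟨R, hR⟩ := hnat φ
    exact ⟨ℓ k R * ‖φ‖, by rintro _ ⟨t, rfl⟩; exact hgle k R φ hR t⟩
  have hgW : ∀ k t φ, g k t φ ≤ W k φ := fun k t φ => le_ciSup (hgb k φ) t
  have hW0 : ∀ k φ, 0 ≤ W k φ := fun k φ => (hg0 k 0 φ).trans (hgW k 0 φ)
  have hWz : ∀ k, W k 0 = 0 := fun k => by simp [hW, hgz]
  have hWL : ∀ k R φ ψ, ‖φ‖ ≤ (R : ℕ) → ‖ψ‖ ≤ R → |W k φ - W k ψ| ≤ ℓ k R * ‖φ - ψ‖ := by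
    have : ∀ k R φ ψ, ‖φ‖ ≤ (R : ℕ) → ‖ψ‖ ≤ R → W k φ - W k ψ ≤ ℓ k R * ‖φ - ψ‖ :=
      fun k R φ ψ hφ hψ => by
        rw [sub_le_iff_le_add]
        exact ciSup_le fun t => by linarith [hℓ k R φ ψ hφ hψ t, hgW k t ψ]
    intro k R φ ψ hφ hψ
    rw [abs_sub_le_iff]
    exact ⟨this k R φ ψ hφ hψ, norm_sub_rev φ ψ ▸ this k R ψ φ hψ hφ⟩
  have hWdec : ∀ k h φ, 0 ≤ h → W k (S h φ) ≤ Real.exp (-h) * W k φ := fun k h φ hh => by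
    lift h to ℝ≥0 using hh
    refine ciSup_le fun t => ?_
    have h2 : g k t (S h φ) = Real.exp (-h) * g k (t + h) φ := by
      simp only [hg, NNReal.coe_add]
      rw [hSadd t h φ t.2 h.2, Real.exp_add, Real.exp_neg]
      field_simp
    rw [h2]
    exact mul_le_mul_of_nonneg_left (hgW k (t + h) φ) (Real.exp_nonneg _)
  -- weights making the series of Lipschitz constants summable on every ball
  set w : ℕ → ℝ := fun k => (1 / 2) ^ k / (1 + ∑ j ∈ Finset.range (k + 1), ℓ k j) with hw
  have hden : ∀ k, 0 < 1 + ∑ j ∈ Finset.range (k + 1), ℓ k j := fun k => by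
    have := Finset.sum_nonneg fun j (_ : j ∈ Finset.range (k + 1)) => hℓ0 k j
    linarith
  have hw0 : ∀ k, 0 < w k := fun k => div_pos (by positivity) (hden k)
  have hgeo : Summable fun k : ℕ => ((1 : ℝ) / 2) ^ k := summable_geometric_two
  have hws : Summable w := by
    refine Summable.of_nonneg_of_le (fun k => (hw0 k).le) (fun k => ?_) hgeo
    refine div_le_self (by positivity) ?_
    linarith [Finset.sum_nonneg fun j (_ : j ∈ Finset.range (k + 1)) => hℓ0 k j]
  have hwℓ : ∀ R, Summable fun k => w k * ℓ k R := fun R => by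
    rw [← summable_nat_add_iff R]
    refine Summable.of_nonneg_of_le (fun k => mul_nonneg (hw0 _).le (hℓ0 _ _)) (fun k => ?_)
      ((summable_nat_add_iff R).mpr hgeo)
    simp only [hw]
    rw [div_mul_eq_mul_div, div_le_iff₀ (hden _)]
    gcongr
    have := Finset.single_le_sum (f := fun j => ℓ (k + R) j) (fun j _ => hℓ0 (k + R) j)
      (Finset.mem_range.mpr (by omega : R < k + R + 1))
    linarith
  have hsum : ∀ φ, Summable fun k => w k * W k φ := fun φ => by
    obtain ⟨R, hR⟩ := hnat φ
    refine Summable.of_nonneg_of_le (fun k => mul_nonneg (hw0 k).le (hW0 k φ)) (fun k => ?_)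
      ((hwℓ R).mul_right ‖φ‖)
    rw [mul_assoc]
    exact mul_le_mul_of_nonneg_left (ciSup_le fun t => hgle k R φ hR t) (hw0 k).le
  refine ⟨fun φ => ∑' k, w k * W k φ, by simp [hWz], fun r hr => ?_, ?_, fun h φ hh => ?_⟩
  · obtain ⟨R, hR⟩ := exists_nat_ge r
    have h0 : 0 ≤ ∑' k, w k * ℓ k R := tsum_nonneg fun k => mul_nonneg (hw0 k).le (hℓ0 k R)
    refine ⟨(∑' k, w k * ℓ k R) + 1, by linarith, fun φ ψ hφ hψ => ?_⟩
    rw [← (hsum φ).tsum_sub (hsum ψ)]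
    have h1 : ∀ k, ‖w k * W k φ - w k * W k ψ‖ ≤ w k * ℓ k R * ‖φ - ψ‖ := fun k => by
      rw [← mul_sub, norm_mul, Real.norm_of_nonneg (hw0 k).le, Real.norm_eq_abs, mul_assoc]
      exact mul_le_mul_of_nonneg_left (hWL k R φ ψ (hφ.trans hR) (hψ.trans hR)) (hw0 k).le
    have h2 := tsum_of_norm_bounded ((hwℓ R).mul_right ‖φ - ψ‖).hasSum h1
    rw [tsum_mul_right, Real.norm_eq_abs] at h2
    linarith [norm_nonneg (φ - ψ)]
  · have hαs : ∀ s : ℝ, Summable fun k => w k * max 0 (s - e k) := fun s => by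
      refine Summable.of_nonneg_of_le (fun k => mul_nonneg (hw0 k).le (le_max_left _ _))
        (fun k => ?_) (hws.mul_right |s|)
      refine mul_le_mul_of_nonneg_left (max_le (abs_nonneg s) ?_) (hw0 k).le
      linarith [le_abs_self s, he0 k]
    have hαm : ∀ s s' : ℝ, s ≤ s' → ∀ k, w k * max 0 (s - e k) ≤ w k * max 0 (s' - e k) :=
      fun s s' h k => mul_le_mul_of_nonneg_left (max_le_max le_rfl (by linarith)) (hw0 k).le
    refine ⟨fun s => ∑' k, w k * max 0 (s - e k), ⟨⟨?_, ?_, ?_⟩, ?_⟩, fun φ => ?_⟩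
    · refine LipschitzWith.continuous (K := Real.toNNReal (∑' k, w k))
        (LipschitzWith.of_dist_le_mul fun s s' => ?_) |>.continuousOn
      rw [Real.dist_eq, Real.dist_eq, ← (hαs s).tsum_sub (hαs s'), ← Real.norm_eq_abs]
      rw [Real.coe_toNNReal _ (tsum_nonneg fun k => (hw0 k).le), ← tsum_mul_right]
      refine tsum_of_norm_bounded (hws.mul_right _).hasSum fun k => ?_
      rw [← mul_sub, norm_mul, Real.norm_of_nonneg (hw0 k).le, Real.norm_eq_abs]
      refine mul_le_mul_of_nonneg_left ?_ (hw0 k).le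
      have := abs_max_sub_max_le_abs (s - e k) (s' - e k) 0
      rwa [sub_sub_sub_cancel_right, max_comm, max_comm _ (0 : ℝ)] at this
    · intro s hs s' _ h
      obtain ⟨k, hk⟩ := exists_nat_one_div_lt (lt_of_le_of_lt hs h)
      refine Summable.tsum_lt_tsum (i := k) (hαm s s' h.le) ?_ (hαs s) (hαs s')
      refine mul_lt_mul_of_pos_left (lt_max_of_lt_right ?_) (hw0 k)
      exact max_lt (sub_pos.mpr hk) (by linarith)
    · refine (tsum_congr fun k => ?_).trans tsum_zero
      rw [max_eq_left (by linarith [he0 k]), mul_zero]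
    · have h1 : Tendsto (fun s : ℝ => w 0 * (s - e 0)) atTop atTop :=
        (tendsto_atTop_add_const_right _ _ tendsto_id).const_mul_atTop (hw0 0)
      refine tendsto_atTop_mono (fun s => ?_) h1
      refine (mul_le_mul_of_nonneg_left (le_max_right 0 _) (hw0 0).le).trans ?_
      exact (hαs s).le_tsum 0 fun k _ => mul_nonneg (hw0 k).le (le_max_left _ _)
    · refine (hαs _).tsum_le_tsum (fun k => ?_) (hsum φ)
      refine mul_le_mul_of_nonneg_left ?_ (hw0 k).le
      have := hgW k 0 φ
      simpa [hg, hS0] using this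
  · simp only
    rw [← tsum_mul_left]
    refine (hsum _).tsum_le_tsum (fun k => ?_) ((hsum φ).mul_left _)
    calc _ ≤ w k * (Real.exp (-h) * W k φ) := mul_le_mul_of_nonneg_left (hWdec k h φ hh) (hw0 k).le
      _ = _ := by ring

/-- A functional vanishing at the origin and Lipschitz on bounded sets is dominated by a
class-`𝒦∞` function of the norm. -/
theorem exists_classKinf_upper_bound {E : Type*} [NormedAddCommGroup E] {V : E → ℝ}
    (hV0 : V 0 = 0) (hV : ∀ r : ℝ, 0 < r → ∃ L : ℝ, 0 < L ∧
      ∀ φ ψ, ‖φ‖ ≤ r → ‖ψ‖ ≤ r → |V φ - V ψ| ≤ L * ‖φ - ψ‖) :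
    ∃ α, ClassKinf α ∧ ∀ φ, V φ ≤ α ‖φ‖ := by
  choose L hL hVL using fun k : ℕ => hV (k + 1) (by positivity)
  set g : ℝ → ℝ := fun r => ∑ k ∈ Finset.range (⌈r⌉₊ + 1), L k with hg
  have hgm : Monotone g := fun r r' h =>
    Finset.sum_le_sum_of_subset_of_nonneg
      (Finset.range_mono (by have := Nat.ceil_mono h; omega)) fun k _ _ => (hL k).le
  have hg0 : ∀ r, 0 ≤ g r := fun r => Finset.sum_nonneg fun k _ => (hL k).le
  have hi : ∀ a b, IntervalIntegrable g volume a b := fun a b => hgm.intervalIntegrable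
  set G : ℝ → ℝ := fun r => ∫ u in r..(r + 1), g u with hG
  have hGc : Continuous G := by
    have : G = fun r => (∫ v in (0 : ℝ)..(r + 1), g v) - ∫ v in (0 : ℝ)..r, g v := by
      funext t
      rw [intervalIntegral.integral_interval_sub_left (hi _ _) (hi _ _)]
    rw [this]
    have hc := intervalIntegral.continuous_primitive hi 0
    exact (hc.comp (continuous_id.add continuous_const)).sub hc
  have hGm : Monotone G := fun r r' h => by
    have e : ∀ r, G r = ∫ u in (0 : ℝ)..1, g (u + r) := fun r => by
      rw [intervalIntegral.integral_comp_add_right]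
      simp [hG, add_comm]
    rw [e, e]
    have hm : ∀ r, Monotone fun u => g (u + r) := fun r a b hab => hgm (by linarith)
    exact intervalIntegral.integral_mono_on zero_le_one (hm r).intervalIntegrable
      (hm r').intervalIntegrable fun u _ => hgm (by linarith)
  have hgG : ∀ r, g r ≤ G r := fun r => by
    have := intervalIntegral.integral_mono_on (by linarith : r ≤ r + 1)
      (intervalIntegrable_const (μ := volume) (c := g r)) (hi _ _) fun u hu => hgm hu.1
    rw [intervalIntegral.integral_const] at this
    simpa using this
  have hG0 : ∀ r, 0 ≤ G r := fun r => (hg0 r).trans (hgG r)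
  refine ⟨fun r => r + r * G r, ⟨⟨by fun_prop, fun r hr r' _ h => ?_, by simp⟩, ?_⟩, fun φ => ?_⟩
  · exact add_lt_add_of_lt_of_le h
      (mul_le_mul h.le (hGm h.le) (hG0 r) ((mem_Ici.mp hr).trans h.le))
  · refine tendsto_atTop_mono' _ ?_ tendsto_id
    filter_upwards [eventually_ge_atTop 0] with r hr
    have := mul_nonneg hr (hG0 r)
    simp only [id]
    linarith
  · have h1 := hVL ⌈‖φ‖⌉₊ φ 0 ((Nat.le_ceil _).trans (by linarith)) (by rw [norm_zero]; positivity)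
    rw [hV0, sub_zero, sub_zero] at h1
    have h2 : L ⌈‖φ‖⌉₊ ≤ g ‖φ‖ :=
      Finset.single_le_sum (f := L) (fun k _ => (hL k).le) (Finset.self_mem_range_succ _)
    have h3 : L ⌈‖φ‖⌉₊ * ‖φ‖ ≤ G ‖φ‖ * ‖φ‖ := by
      gcongr; exact h2.trans (hgG _)
    linarith [le_abs_self (V φ), norm_nonneg φ]

variable {Δ : ℝ≥0} {n : ℕ} {f : Hist Δ n → Vec n}

theorem GAS.exists_coerciveLKF (hf : LipOnBounded₀ f) (hf0 : f 0 = 0) (h : GAS Δ f) :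
    ∃ V : Hist Δ n → ℝ, IsCoerciveLKF V ∧
      ∀ φ : Hist Δ n, driverD V φ (f φ) ≤ ((-V φ : ℝ) : EReal) := by
  obtain ⟨β, hβ, hβx⟩ := h
  have hΔ := Δ.coe_nonneg
  have hex : ∀ (φ : Hist Δ n) (T : ℝ), 0 ≤ T → ∃ x, IsTraj Δ f φ T x := fun φ T hT => by
    obtain ⟨b, x, hx⟩ := exists_isMaxSolution hf hf0 φ
    have hb := (hβx φ b x hx).1
    obtain ⟨z, hz, -⟩ := IsSolution.exists_isTraj hx.1 hT (hb ▸ EReal.coe_lt_top T)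
    exact ⟨z, hz⟩
  have hbd : ∀ {φ T x}, IsTraj Δ f φ T x → ∀ t ∈ Icc 0 T, ‖x t‖ ≤ β ‖φ‖ t :=
    fun {φ T x} hx t ht => by
      obtain ⟨b, y, hy⟩ := exists_isMaxSolution hf hf0 φ
      obtain ⟨hb, hyβ⟩ := hβx φ b y hy
      obtain ⟨z, hz, hzy⟩ := IsSolution.exists_isTraj hy.1 ht.1 (hb ▸ EReal.coe_lt_top t)
      have ht' : t ∈ Icc (-(Δ : ℝ)) t := ⟨by linarith [ht.1], le_rfl⟩
      rw [(hx.mono ht.2).unique hf hz ht', hzy ht']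
      exact hyβ t ht.1
  choose! X hX using hex
  set S : ℝ → Hist Δ n → Hist Δ n := fun t φ => seg Δ (X φ t) t with hS
  have hSseg : ∀ {φ T x}, IsTraj Δ f φ T x → ∀ t ∈ Icc 0 T, S t φ = seg Δ x t :=
    fun {φ T x} hx t ht => (hX φ t ht.1).seg_unique hf (hx.mono ht.2) ⟨ht.1, le_rfl⟩
  have hSadd : ∀ t h φ, 0 ≤ t → 0 ≤ h → S t (S h φ) = S (t + h) φ := fun t h φ ht hh => by
    have hx := hX φ (t + h) (by positivity)
    rw [hSseg hx h ⟨hh, by linarith⟩]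
    have := hx.shift hf hh
    rw [hSseg this t ⟨ht, by linarith⟩, seg_comp_add hx.cont]
  have hSbd : ∀ R : ℝ, 0 < R → ∃ M : ℝ, 0 < M ∧ ∀ φ T x, ‖φ‖ ≤ R → IsTraj Δ f φ T x →
      ∀ t ∈ Icc 0 T, ‖seg Δ x t‖ ≤ M := fun R hR => by
    have hβR := (hβ.1 0 le_rfl).nonneg hR.le
    refine ⟨β R 0 + R, by linarith, fun φ T x hφ hx t ht => ?_⟩
    refine norm_seg_le hx.cont (by linarith) fun s hs => ?_
    by_cases hs0 : 0 ≤ s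
    · have h1 := hbd hx s ⟨hs0, hs.2.trans ht.2⟩
      have h2 := (hβ.2 ‖φ‖ (norm_nonneg _)).2.1 self_mem_Ici hs0 hs0
      have h3 := (hβ.1 0 le_rfl).2.1.monotoneOn (norm_nonneg φ) hR.le hφ
      linarith
    · push Not at hs0
      rw [hx.init ⟨s, by linarith [hs.1, ht.1], hs0.le⟩]
      linarith [φ.norm_coe_le_norm ⟨s, by linarith [hs.1, ht.1], hs0.le⟩]
  have hS0 : ∀ φ, S 0 φ = φ := fun φ => (hX φ 0 le_rfl).seg_zero
  have hβ0 : ∀ t, 0 ≤ t → β 0 t = 0 := fun t ht => (hβ.1 t ht).2.2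
  have hSz : ∀ t, 0 ≤ t → S t 0 = 0 := fun t ht => by
    rw [← norm_le_zero_iff]
    have hx := hX 0 t ht
    refine norm_seg_le hx.cont le_rfl fun s hs => ?_
    by_cases hs0 : 0 ≤ s
    · have := hbd hx s ⟨hs0, hs.2⟩
      rwa [norm_zero, hβ0 s hs0] at this
    · push Not at hs0
      rw [hx.init ⟨s, by linarith [hs.1], hs0.le⟩]
      simp
  obtain ⟨V, hV0, hVL, ⟨α₁, hα₁, hVα₁⟩, hdec⟩ := exists_lyapunov_of_semiflow hS0 hSadd hSz
    (fun R T hR hT => by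
      obtain ⟨M, hM, hMb⟩ := hSbd R hR
      obtain ⟨L, hL, hfL⟩ := hf M hM
      refine ⟨Real.exp (L * T), by positivity, fun φ ψ hφ hψ t ht => ?_⟩
      have hx := hX φ t ht.1
      have hy := hX ψ t ht.1
      refine (hx.norm_seg_sub_le hf hy hL.le hfL (hMb φ t _ hφ hx) (hMb ψ t _ hψ hy) t
        ⟨ht.1, le_rfl⟩).trans ?_
      rw [mul_comm]
      gcongr
      exact ht.2)
    (fun R ε hR hε => by
      have h1 := ((hβ.2 R hR.le).2.2.eventually_le_const hε).and (eventually_ge_atTop 0)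
      obtain ⟨T, hT, hT0⟩ := h1.exists
      refine ⟨T + Δ, by positivity, fun φ hφ t ht => ?_⟩
      have ht0 : 0 ≤ t := by linarith
      have hx := hX φ t ht0
      refine norm_seg_le hx.cont hε.le fun s hs => ?_
      have hsT : T ≤ s := by linarith [hs.1]
      have hs0 : 0 ≤ s := hT0.trans hsT
      have h2 := hbd hx s ⟨hs0, hs.2⟩
      have h3 := (hβ.1 s hs0).2.1.monotoneOn (norm_nonneg φ) hR.le hφ
      have h4 := (hβ.2 R hR.le).2.1 hT0 hs0 hsT
      linarith)
  obtain ⟨α₂, hα₂, hVα₂⟩ := exists_classKinf_upper_bound hV0 hVL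
  refine ⟨V, ⟨fun φ => (hα₁.1.nonneg (norm_nonneg _)).trans (hVα₁ φ), hVL, α₁, α₂, hα₁, hα₂,
    fun φ => ⟨hVα₁ φ, hVα₂ φ⟩⟩, fun φ => ?_⟩
  exact (hX φ 1 zero_le_one).driverD_le_neg hf one_pos hVL fun h hh =>
    hSseg (hX φ 1 zero_le_one) h hh ▸ hdec h φ hh.1

theorem IsCoerciveLKF.isLKF {V : Hist Δ n → ℝ} (hV : IsCoerciveLKF V) : IsLKF V := by
  obtain ⟨h0, hL, α₁, α₂, hα₁, hα₂, h⟩ := hV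
  exact ⟨h0, hL, α₁, α₂, hα₁, hα₂, fun φ =>
    ⟨(hα₁.1.2.1.monotoneOn (norm_nonneg _) (norm_nonneg φ) (norm_ev0_le φ)).trans (h φ).1,
      (h φ).2⟩⟩

theorem ClassK.classKL_mul_exp_neg {α : ℝ → ℝ} (hα : ClassK α) :
    ClassKL fun s t => α s * Real.exp (-t) := by
  refine ⟨fun t _ => ⟨hα.1.mul continuousOn_const, fun s hs s' hs' h => ?_, ?_⟩, fun s hs =>
    ⟨by fun_prop, fun t _ t' _ h => ?_, ?_⟩⟩
  · exact mul_lt_mul_of_pos_right (hα.2.1 hs hs' h) (Real.exp_pos _)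
  · simp [hα.2.2]
  · exact mul_le_mul_of_nonneg_left (Real.exp_le_exp.mpr (neg_le_neg h)) (hα.nonneg hs)
  · simpa using Real.tendsto_exp_neg_atTop_nhds_zero.const_mul (α s)

end Converse

/-- LKF characterization of GAS. -/
theorem gas_LKF_characterization
    (Δ : ℝ≥0) (n : ℕ) (f₀ : Hist Δ n → Vec n)
    (hf : LipOnBounded₀ f₀) (hf0 : f₀ 0 = 0) :
    List.TFAE
      [GAS Δ f₀,
       ∃ V : Hist Δ n → ℝ, IsLKF V ∧ ∃ σ : ℝ → ℝ → ℝ, ClassKL σ ∧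
         ∀ φ : Hist Δ n, driverD V φ (f₀ φ) ≤ ((-σ ‖ev0 φ‖ ‖φ‖ : ℝ) : EReal),
       ∃ V : Hist Δ n → ℝ, IsLKF V ∧ ∃ α : ℝ → ℝ, ClassP α ∧
         ∀ φ : Hist Δ n, driverD V φ (f₀ φ) ≤ ((-α ‖ev0 φ‖ : ℝ) : EReal),
       ∃ V : Hist Δ n → ℝ, IsLKF V ∧
         ∀ φ : Hist Δ n, driverD V φ (f₀ φ) ≤ ((-V φ : ℝ) : EReal),
       ∃ V : Hist Δ n → ℝ, IsCoerciveLKF V ∧ ∃ α : ℝ → ℝ, ClassKinf α ∧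
         ∀ φ : Hist Δ n, driverD V φ (f₀ φ) ≤ ((-α ‖φ‖ : ℝ) : EReal)] := by
  have hle : ∀ {a b : ℝ}, b ≤ a → ((-a : ℝ) : EReal) ≤ ((-b : ℝ) : EReal) := fun h =>
    EReal.coe_le_coe_iff.mpr (neg_le_neg h)
  tfae_have 1 → 4 := fun h =>
    let ⟨V, hV, hd⟩ := h.exists_coerciveLKF hf hf0
    ⟨V, hV.isLKF, hd⟩
  tfae_have 1 → 5 := by
    intro h
    obtain ⟨V, hV, hd⟩ := h.exists_coerciveLKF hf hf0
    obtain ⟨-, -, α₁, α₂, hα₁, -, hb⟩ := id hV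
    exact ⟨V, hV, α₁, hα₁, fun φ => (hd φ).trans (hle (hb φ).1)⟩
  tfae_have 4 → 3 := by
    rintro ⟨V, hV, hd⟩
    obtain ⟨-, -, α₁, α₂, hα₁, -, hb⟩ := id hV
    exact ⟨V, hV, α₁, hα₁.1.classP, fun φ => (hd φ).trans (hle (hb φ).1)⟩
  tfae_have 4 → 2 := by
    rintro ⟨V, hV, hd⟩
    obtain ⟨-, -, α₁, α₂, hα₁, -, hb⟩ := id hV
    refine ⟨V, hV, _, hα₁.1.classKL_mul_exp_neg, fun φ => (hd φ).trans (hle ?_)⟩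
    refine (mul_le_of_le_one_right (hα₁.1.nonneg (norm_nonneg _)) ?_).trans (hb φ).1
    exact Real.exp_le_one_iff.mpr (neg_nonpos.mpr (norm_nonneg φ))
  tfae_have 2 → 1 := fun ⟨V, hV, σ, hσ, hd⟩ => HasPointwiseLKF.gas hf hf0
    ⟨V, hV, fun M hM => ⟨fun s => σ s M, (hσ.1 M hM.le).classP, fun φ hφ => (hd φ).trans
      (hle ((hσ.2 _ (norm_nonneg _)).2.1 (norm_nonneg φ) hM.le hφ))⟩⟩
  tfae_have 3 → 1 := fun ⟨V, hV, α, hα, hd⟩ => HasPointwiseLKF.gas hf hf0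
    ⟨V, hV, fun _ _ => ⟨α, hα, fun φ _ => hd φ⟩⟩
  tfae_have 5 → 1 := fun ⟨V, hV, α, hα, hd⟩ => HasPointwiseLKF.gas hf hf0
    ⟨V, hV.isLKF, fun _ _ => ⟨α, hα.1.classP, fun φ _ => (hd φ).trans
      (hle (hα.1.2.1.monotoneOn (norm_nonneg _) (norm_nonneg φ) (norm_ev0_le φ)))⟩⟩
  tfae_finish
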